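/- arXiv:2301.06686 — 8 statements merged into one kernel-verified Lean document; each statement's English description precedes it below -/
import Mathlib

section
/- Let ν be a real number and let z be a complex number with Re z > 0. Then K_ν(z) ≠ 0. -/
open MeasureTheory

/-- The modified Bessel function of the second kind,
`K_ν(z) = ∫₀^∞ e^{-z cosh t} cosh(ν t) dt`, for `Re z > 0`. -/
noncomputable def besselK (ν : ℝ) (z : ℂ) : ℂ :=
  ∫ t in Set.Ioi (0 : ℝ), Complex.exp (-z * Real.cosh t) * (Real.cosh (ν * t) : ℂ)

lemma bk_cosh_le (a u : ℝ) (hu : 0 ≤ u) : Real.cosh (a * u) ≤ Real.exp (|a| * u) := by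
  rw [← Real.cosh_abs, abs_mul, abs_of_nonneg hu, Real.cosh_eq]
  have : Real.exp (-(|a| * u)) ≤ Real.exp (|a| * u) := by
    apply Real.exp_le_exp.2
    have : 0 ≤ |a| * u := by positivity
    linarith
  linarith

lemma bk_abs_sinh_le (a : ℝ) : |Real.sinh a| ≤ Real.cosh a := by
  rw [Real.abs_sinh, ← Real.cosh_abs]
  exact (Real.sinh_lt_cosh _).le

lemma bk_bound (x k : ℝ) (hx : 0 < x) (u : ℝ) (hu : 0 ≤ u) :
    Real.exp (-x * Real.cosh u) * Real.exp (k * u) ≤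
      Real.exp (2 * k ^ 2 / x) * Real.exp (-(x / 8) * u ^ 2) := by
  rw [← Real.exp_add, ← Real.exp_add]
  apply Real.exp_le_exp.2
  have h1 : u ^ 2 / 4 ≤ Real.cosh u := by
    have := Real.quadratic_le_exp_of_nonneg hu
    have h2 := Real.exp_pos (-u)
    rw [Real.cosh_eq]
    linarith
  have h2 : k * u ≤ x / 8 * u ^ 2 + 2 * k ^ 2 / x := by
    have : x / 8 * u ^ 2 + 2 * k ^ 2 / x - k * u = (x * u - 4 * k) ^ 2 / (8 * x) := by
      field_simp
      ring
    have h3 : 0 ≤ (x * u - 4 * k) ^ 2 / (8 * x) := by positivity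
    linarith
  nlinarith [mul_le_mul_of_nonneg_left h1 hx.le]

noncomputable def bkG (ν : ℝ) (n : ℕ) (z : ℂ) (u : ℝ) : ℂ :=
  Complex.exp (-z * Real.cosh u) * ((Real.cosh u ^ n * Real.cosh (ν * u) : ℝ) : ℂ)

noncomputable def bkM (ν : ℝ) (n : ℕ) (z : ℂ) : ℂ := ∫ u in Set.Ioi (0 : ℝ), bkG ν n z u

lemma bkG_cont (ν : ℝ) (n : ℕ) (z : ℂ) : Continuous (bkG ν n z) := by
  unfold bkG
  have := Real.continuous_cosh
  fun_prop

lemma bkG_norm (ν : ℝ) (n : ℕ) (z : ℂ) (u : ℝ) :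
    ‖bkG ν n z u‖ = Real.exp (-z.re * Real.cosh u) * (Real.cosh u ^ n * Real.cosh (ν * u)) := by
  have h1 := Real.cosh_pos u
  have h2 := Real.cosh_pos (ν * u)
  rw [bkG, norm_mul, Complex.norm_exp, Complex.norm_real, Real.norm_of_nonneg (by positivity)]
  simp

lemma bk_poly_le (ν : ℝ) (n : ℕ) (u : ℝ) (hu : 0 ≤ u) :
    Real.cosh u ^ n * Real.cosh (ν * u) ≤ Real.exp ((n + |ν|) * u) := by
  have h1 := Real.cosh_pos u
  have h3 := bk_cosh_le 1 u hu
  rw [abs_one, one_mul] at h3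
  rw [add_mul, Real.exp_add, Real.exp_nat_mul]
  gcongr
  · exact bk_cosh_le ν u hu

lemma bkG_le (ν : ℝ) (n : ℕ) (x : ℝ) (hx : 0 < x) (z : ℂ) (hz : x ≤ z.re) (u : ℝ) (hu : 0 ≤ u) :
    ‖bkG ν n z u‖ ≤
      Real.exp (2 * (n + |ν|) ^ 2 / x) * Real.exp (-(x / 8) * u ^ 2) := by
  rw [bkG_norm]
  refine le_trans ?_ (bk_bound x _ hx u hu)
  have h1 := Real.cosh_pos u
  have h2 := bk_poly_le ν n u hu
  gcongr

lemma bk_bound_int (C x : ℝ) (hx : 0 < x) :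
    IntegrableOn (fun u : ℝ => C * Real.exp (-(x / 8) * u ^ 2)) (Set.Ioi 0) :=
  ((integrable_exp_neg_mul_sq (by positivity : 0 < x / 8)).const_mul C).integrableOn

lemma bkG_int (ν : ℝ) (n : ℕ) (z : ℂ) (hz : 0 < z.re) :
    IntegrableOn (bkG ν n z) (Set.Ioi 0) := by
  refine Integrable.mono' (bk_bound_int (Real.exp (2 * (n + |ν|) ^ 2 / z.re)) z.re hz)
    (bkG_cont ν n z).aestronglyMeasurable ?_
  filter_upwards [ae_restrict_mem measurableSet_Ioi] with u hu
  exact bkG_le ν n z.re hz z le_rfl u (le_of_lt hu)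

lemma bkM_deriv (ν : ℝ) (n : ℕ) (z : ℂ) (hz : 0 < z.re) :
    HasDerivAt (bkM ν n) (-bkM ν (n + 1) z) z := by
  have hs : {w : ℂ | z.re / 2 < w.re} ∈ nhds z :=
    (isOpen_lt continuous_const Complex.continuous_re).mem_nhds (by simp; linarith)
  have h := (hasDerivAt_integral_of_dominated_loc_of_deriv_le (μ := volume.restrict (Set.Ioi 0))
    (F := bkG ν n) (F' := fun w u => -bkG ν (n + 1) w u) (x₀ := z)
    (bound := fun u => Real.exp (2 * ((n + 1 : ℕ) + |ν|) ^ 2 / (z.re / 2)) *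
      Real.exp (-((z.re / 2) / 8) * u ^ 2)) hs
    (Filter.Eventually.of_forall fun w => (bkG_cont ν n w).aestronglyMeasurable)
    (bkG_int ν n z hz) (bkG_cont ν (n + 1) z).neg.aestronglyMeasurable ?_
    (bk_bound_int _ _ (by positivity)) ?_).2
  · rw [integral_neg] at h
    exact h
  · filter_upwards [ae_restrict_mem measurableSet_Ioi] with u hu w hw
    rw [norm_neg]
    exact bkG_le ν (n + 1) (z.re / 2) (by positivity) w (le_of_lt hw) u (le_of_lt hu)
  · refine Filter.Eventually.of_forall fun u w _ => ?_
    unfold bkG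
    have h1 : HasDerivAt (fun w : ℂ => -w * (Real.cosh u : ℂ)) (-1 * (Real.cosh u : ℂ)) w :=
      (hasDerivAt_id w).neg.mul_const _
    have h2 := h1.cexp.mul_const ((Real.cosh u ^ n * Real.cosh (ν * u) : ℝ) : ℂ)
    refine h2.congr_deriv ?_
    push_cast
    ring

lemma bkM_ode (ν : ℝ) (z : ℂ) (hz : 0 < z.re) :
    z ^ 2 * bkM ν 2 z - z * bkM ν 1 z = (z ^ 2 + ν ^ 2) * bkM ν 0 z := by
  set F : ℝ → ℂ := fun u => Complex.exp (-z * Real.cosh u) *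
    (-z * ((Real.sinh u : ℝ) : ℂ) * ((Real.cosh (ν * u) : ℝ) : ℂ)
      - ν * ((Real.sinh (ν * u) : ℝ) : ℂ)) with hF
  have hd : ∀ u : ℝ, HasDerivAt F (z ^ 2 * bkG ν 2 z u - z * bkG ν 1 z u
      - (z ^ 2 + ν ^ 2) * bkG ν 0 z u) u := by
    intro u
    have hc := (Real.hasDerivAt_cosh u).ofReal_comp
    have hs := (Real.hasDerivAt_sinh u).ofReal_comp
    have hν : HasDerivAt (fun u : ℝ => ν * u) ν u := by
      simpa using (hasDerivAt_id u).const_mul ν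
    have hcν := hν.cosh.ofReal_comp
    have hsν := hν.sinh.ofReal_comp
    have h := (hc.const_mul (-z)).cexp.mul
      (((hs.const_mul (-z)).mul hcν).sub (hsν.const_mul (ν : ℂ)))
    refine h.congr_deriv ?_
    have e : ((Real.cosh u : ℝ) : ℂ) ^ 2 = ((Real.sinh u : ℝ) : ℂ) ^ 2 + 1 := by
      exact_mod_cast Real.cosh_sq u
    simp only [bkG, Pi.sub_apply, Pi.mul_apply]
    push_cast at e ⊢
    simp only [pow_zero, pow_one]
    rw [e]
    ring
  have hint : IntegrableOn (fun u => z ^ 2 * bkG ν 2 z u - z * bkG ν 1 z u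
      - (z ^ 2 + ν ^ 2) * bkG ν 0 z u) (Set.Ioi 0) :=
    (((bkG_int ν 2 z hz).const_mul _).sub ((bkG_int ν 1 z hz).const_mul _)).sub
      ((bkG_int ν 0 z hz).const_mul _)
  have ht : Filter.Tendsto F Filter.atTop (nhds 0) := by
    have hb : ∀ᶠ u : ℝ in Filter.atTop, ‖F u‖ ≤ (‖z‖ + |ν|) *
        (Real.exp (2 * ((1 : ℕ) + |ν|) ^ 2 / z.re) * Real.exp (-(z.re / 8) * u ^ 2)) := by
      filter_upwards [Filter.eventually_ge_atTop 0] with u hu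
      refine le_trans ?_ (mul_le_mul_of_nonneg_left (bkG_le ν 1 z.re hz z le_rfl u hu)
        (by positivity))
      rw [bkG_norm, hF]
      simp only
      rw [norm_mul, Complex.norm_exp]
      have e1 : (-z * (Real.cosh u : ℂ)).re = -z.re * Real.cosh u := by simp
      rw [e1]
      have h1 := Real.one_le_cosh u
      have h2 := Real.one_le_cosh (ν * u)
      have h3 := bk_abs_sinh_le u
      have h4 := bk_abs_sinh_le (ν * u)
      have e2 : ‖-z * ((Real.sinh u : ℝ) : ℂ) * ((Real.cosh (ν * u) : ℝ) : ℂ)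
          - ν * ((Real.sinh (ν * u) : ℝ) : ℂ)‖ ≤
          ‖z‖ * (Real.cosh u * Real.cosh (ν * u)) + |ν| * (Real.cosh u * Real.cosh (ν * u)) := by
        refine (norm_sub_le _ _).trans ?_
        rw [norm_mul, norm_mul, norm_mul, norm_neg, Complex.norm_real, Complex.norm_real,
          Complex.norm_real, Complex.norm_real, Real.norm_eq_abs, Real.norm_eq_abs,
          Real.norm_eq_abs, Real.norm_eq_abs, abs_of_nonneg (by linarith : 0 ≤ Real.cosh (ν * u)),
          mul_assoc]
        gcongr
        nlinarith
      calc _ ≤ Real.exp (-z.re * Real.cosh u) * _ :=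
            mul_le_mul_of_nonneg_left e2 (Real.exp_pos _).le
        _ = _ := by ring
    refine squeeze_zero_norm' hb ?_
    have h1 : Filter.Tendsto (fun u : ℝ => -(z.re / 8) * u ^ 2) Filter.atTop Filter.atBot :=
      (Filter.tendsto_pow_atTop two_ne_zero).const_mul_atTop_of_neg (by linarith)
    have h2 := ((Real.tendsto_exp_atBot.comp h1).const_mul
      (Real.exp (2 * ((1 : ℕ) + |ν|) ^ 2 / z.re))).const_mul (‖z‖ + |ν|)
    simpa using h2
  have h := integral_Ioi_of_hasDerivAt_of_tendsto (hd 0).continuousAt.continuousWithinAt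
    (fun u _ => hd u) hint ht
  have hint2 : IntegrableOn (fun u => z ^ 2 * bkG ν 2 z u - z * bkG ν 1 z u) (Set.Ioi 0) :=
    ((bkG_int ν 2 z hz).const_mul _).sub ((bkG_int ν 1 z hz).const_mul _)
  rw [integral_sub hint2
      ((bkG_int ν 0 z hz).const_mul _),
    integral_sub ((bkG_int ν 2 z hz).const_mul _) ((bkG_int ν 1 z hz).const_mul _),
    integral_const_mul, integral_const_mul, integral_const_mul] at h
  have hF0 : F 0 = 0 := by simp [hF]
  rw [hF0, sub_zero] at h
  exact sub_eq_zero.1 h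

lemma bkM_decay (ν : ℝ) (n : ℕ) (z : ℂ) (hz : 0 < z.re) :
    ∃ C : ℝ, 0 ≤ C ∧ ∀ t : ℝ, 1 ≤ t → ‖bkM ν n (t * z)‖ ≤ C * Real.exp (-(t * z.re)) := by
  refine ⟨Real.exp z.re * ∫ u in Set.Ioi (0 : ℝ), ‖bkG ν n z u‖,
    mul_nonneg (Real.exp_pos _).le (integral_nonneg fun _ => norm_nonneg _), fun t ht => ?_⟩
  have : ‖bkM ν n (t * z)‖ ≤
      ∫ u in Set.Ioi (0 : ℝ), (Real.exp z.re * Real.exp (-(t * z.re))) * ‖bkG ν n z u‖ := by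
    refine norm_integral_le_of_norm_le ((bkG_int ν n z hz).norm.const_mul _) ?_
    refine Filter.Eventually.of_forall fun u => ?_
    rw [bkG_norm, bkG_norm, ← mul_assoc (Real.exp z.re * _), ← Real.exp_add, ← Real.exp_add]
    have h1 := Real.one_le_cosh u
    have h2 := Real.one_le_cosh (ν * u)
    have e : ((t : ℂ) * z).re = t * z.re := by simp
    rw [e]
    gcongr
    have : 0 ≤ (t - 1) * z.re * (Real.cosh u - 1) :=
      mul_nonneg (mul_nonneg (by linarith) hz.le) (by linarith)
    nlinarith
  rw [integral_const_mul] at this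
  linarith

lemma besselK_eq (ν : ℝ) (z : ℂ) : besselK ν z = bkM ν 0 z := by
  simp [besselK, bkM, bkG]

lemma bkM_real (ν : ℝ) (x : ℝ) (hx : 0 < x) : bkM ν 0 x ≠ 0 := by
  have e : bkM ν 0 x = ((∫ u in Set.Ioi (0 : ℝ), ‖bkG ν 0 x u‖ : ℝ) : ℂ) := by
    rw [← integral_complex_ofReal]
    unfold bkM
    congr 1
    ext u
    rw [bkG_norm, bkG]
    push_cast
    simp
  rw [e]
  have : 0 < ∫ u in Set.Ioi (0 : ℝ), ‖bkG ν 0 x u‖ := by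
    rw [setIntegral_pos_iff_support_of_nonneg_ae
      (Filter.Eventually.of_forall fun _ => norm_nonneg _) (bkG_int ν 0 x (by simpa)).norm]
    have : (Function.support fun u => ‖bkG ν 0 x u‖) = Set.univ := by
      ext u
      have := Real.cosh_pos (ν * u)
      simp only [Function.mem_support, Set.mem_univ, iff_true, bkG_norm, pow_zero, one_mul]
      positivity
    rw [this]
    simp
  exact_mod_cast this.ne'

/-- If `K` vanishes on a ray `t z`, `t > 1`, contradiction by the identity theorem. -/
lemma bkM_ray (ν : ℝ) (z : ℂ) (hz : 0 < z.re) (h : ∀ t : ℝ, 1 < t → bkM ν 0 (t * z) = 0) :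
    False := by
  have ho : IsOpen {w : ℂ | 0 < w.re} := isOpen_lt continuous_const Complex.continuous_re
  have ha : AnalyticOnNhd ℂ (bkM ν 0) {w : ℂ | 0 < w.re} :=
    DifferentiableOn.analyticOnNhd
      (fun w hw => (bkM_deriv ν 0 w hw).differentiableAt.differentiableWithinAt) ho
  have hz0 : z ≠ 0 := by
    rintro rfl
    simp at hz
  have hfreq : ∃ᶠ w in nhdsWithin ((2 : ℝ) * z : ℂ) {((2 : ℝ) * z : ℂ)}ᶜ, bkM ν 0 w = 0 := by
    have ht : Filter.Tendsto (fun t : ℝ => (t : ℂ) * z) (nhdsWithin 2 {2}ᶜ)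
        (nhdsWithin ((2 : ℝ) * z : ℂ) {((2 : ℝ) * z : ℂ)}ᶜ) := by
      refine tendsto_nhdsWithin_of_tendsto_nhds_of_eventually_within _ ?_ ?_
      · have : Continuous (fun t : ℝ => (t : ℂ) * z) := by fun_prop
        exact (this.tendsto 2).mono_left nhdsWithin_le_nhds
      · filter_upwards [self_mem_nhdsWithin] with t ht h2
        apply ht
        have := mul_right_cancel₀ hz0 h2
        exact_mod_cast this
    refine ht.frequently (Filter.Eventually.frequently ?_)
    filter_upwards [nhdsWithin_le_nhds (lt_mem_nhds (by norm_num : (1 : ℝ) < 2))] with t ht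
    exact h t ht
  have h0 := ha.eqOn_zero_of_preconnected_of_frequently_eq_zero
    (convex_halfSpace_re_gt 0).isPreconnected (by simpa using hz) hfreq
  have h1 : ((1 : ℝ) : ℂ) ∈ {w : ℂ | 0 < w.re} := by simp
  exact bkM_real ν 1 one_pos (h0 h1)

/-- For `ν ∈ ℝ` and `z ∈ ℂ` with `Re z > 0`, `K_ν(z) ≠ 0`. -/
theorem besselK_ne_zero (ν : ℝ) (z : ℂ) (hz : 0 < z.re) : besselK ν z ≠ 0 := by
  rw [besselK_eq]
  intro h0
  by_cases hy : z.im = 0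
  · have : z = (z.re : ℂ) := by apply Complex.ext <;> simp [hy]
    rw [this] at h0
    exact bkM_real ν z.re hz h0
  -- energy function along the ray
  set P : ℝ → ℂ := fun t => bkM ν 0 (t * z) with hP
  set Q : ℝ → ℂ := fun t => -(t * z) * bkM ν 1 (t * z) with hQ
  have hre : ∀ t : ℝ, 0 < t → 0 < ((t : ℂ) * z).re := fun t ht => by
    simp only [Complex.re_ofReal_mul]
    positivity
  have hlin : ∀ t : ℝ, HasDerivAt (fun t : ℝ => (t : ℂ) * z) z t := fun t => by
    simpa using ((hasDerivAt_id t).ofReal_comp).mul_const z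
  have hM : ∀ n, ∀ t : ℝ, 0 < t →
      HasDerivAt (fun t : ℝ => bkM ν n (t * z)) (-bkM ν (n + 1) (t * z) * z) t :=
    fun n t ht => HasDerivAt.comp (h₂ := bkM ν n) t (bkM_deriv ν n _ (hre t ht)) (hlin t)
  set H : ℝ → ℝ := fun t => (Q t * star (P t)).im with hH
  have hHd : ∀ t : ℝ, 0 < t → HasDerivAt H (2 * z.re * z.im * (t * Complex.normSq (P t))) t := by
    intro t ht
    have hPd := hM 0 t ht
    have hQd := (hlin t).neg.mul (hM 1 t ht)
    have hode := bkM_ode ν _ (hre t ht)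
    have h := hQd.mul hPd.star
    have h' := Complex.imCLM.hasFDerivAt.comp_hasDerivAt t h
    refine h'.congr_deriv ?_
    have ht' : (t : ℂ) ≠ 0 := by exact_mod_cast ht.ne'
    have e1 : -z * bkM ν 1 (t * z) + -(t * z) * (-bkM ν (1 + 1) (t * z) * z)
        = ((t : ℂ) * z ^ 2 + ((ν ^ 2 / t : ℝ) : ℂ)) * bkM ν 0 (t * z) := by
      push_cast
      apply mul_left_cancel₀ ht'
      field_simp
      norm_num
      linear_combination hode
    simp only [Pi.neg_apply, Pi.mul_apply]
    rw [e1]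
    simp only [hP, Complex.imCLM_apply]
    generalize bkM ν 0 (t * z) = A
    norm_num
    generalize bkM ν 1 (t * z) = B
    simp [Complex.normSq_apply, pow_two]
    ring
  have hH1 : H 1 = 0 := by simp [hH, hP, h0]
  have hHlim : Filter.Tendsto H Filter.atTop (nhds 0) := by
    obtain ⟨C, hC, hC'⟩ := bkM_decay ν 0 z hz
    obtain ⟨D, hD, hD'⟩ := bkM_decay ν 1 z hz
    have hb : ∀ᶠ t : ℝ in Filter.atTop, ‖H t‖ ≤ (‖z‖ * D * C / z.re) *
        ((t * z.re) ^ 1 * Real.exp (-(t * z.re))) := by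
      filter_upwards [Filter.eventually_ge_atTop 1] with t ht
      have h1 := hC' t ht
      have h2 := hD' t ht
      have h3 : Real.exp (-(t * z.re)) ≤ 1 := by
        apply Real.exp_le_one_iff.2
        have : 0 ≤ t * z.re := by positivity
        linarith
      calc ‖H t‖ ≤ ‖Q t * star (P t)‖ := Complex.abs_im_le_norm _
        _ = t * ‖z‖ * ‖bkM ν 1 (t * z)‖ * ‖bkM ν 0 (t * z)‖ := by
            simp [hQ, hP, abs_of_nonneg (by linarith : 0 ≤ t)]
        _ ≤ t * ‖z‖ * (D * Real.exp (-(t * z.re))) * (C * 1) := by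
            gcongr
            exact h1.trans (by gcongr)
        _ = _ := by
            field_simp
    refine squeeze_zero_norm' hb ?_
    have := ((Real.tendsto_pow_mul_exp_neg_atTop_nhds_zero 1).comp
      (Filter.tendsto_id.atTop_mul_const hz)).const_mul (‖z‖ * D * C / z.re)
    simpa using this
  -- normalise the sign
  set c : ℝ := 2 * z.re * z.im with hc
  have hc0 : c ≠ 0 := by positivity
  have hGd : ∀ t : ℝ, 0 < t → HasDerivAt (fun t => c * H t)
      (c * (c * (t * Complex.normSq (P t)))) t := fun t ht => (hHd t ht).const_mul c
  have hmono : MonotoneOn (fun t => c * H t) (Set.Ici 1) := by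
    apply monotoneOn_of_deriv_nonneg (convex_Ici 1)
    · intro t ht
      exact (hGd t (lt_of_lt_of_le one_pos ht)).continuousAt.continuousWithinAt
    · intro t ht
      rw [interior_Ici] at ht
      exact (hGd t (one_pos.trans ht)).differentiableAt.differentiableWithinAt
    · intro t ht
      rw [interior_Ici] at ht
      have ht0 : 0 < t := one_pos.trans ht
      rw [(hGd t ht0).deriv, ← mul_assoc]
      exact mul_nonneg (mul_self_nonneg c) (mul_nonneg ht0.le (Complex.normSq_nonneg _))
  have hGlim : Filter.Tendsto (fun t => c * H t) Filter.atTop (nhds 0) := by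
    simpa using hHlim.const_mul c
  have hzero : ∀ t : ℝ, 1 ≤ t → c * H t = 0 := by
    intro t ht
    apply le_antisymm
    · refine ge_of_tendsto hGlim ?_
      filter_upwards [Filter.eventually_ge_atTop t] with s hs
      exact hmono ht (ht.trans hs) hs
    · have := hmono (Set.mem_Ici.2 le_rfl) ht ht
      simpa [hH1] using this
  refine bkM_ray ν z hz fun t ht => ?_
  have ht0 : 0 < t := one_pos.trans ht
  have hd0 : HasDerivAt (fun t => c * H t) 0 t := by
    refine (hasDerivAt_const t (0 : ℝ)).congr_of_eventuallyEq ?_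
    filter_upwards [lt_mem_nhds ht] with s hs
    exact hzero s hs.le
  have h5 := (hGd t ht0).unique hd0
  simpa [hc0, ht0.ne', Complex.normSq_eq_zero] using h5
end

section
/- Let n ≥ 1 be an integer and let z be a complex number with Re z > 0. Then K_n(z) ≠ 0 and Re(K_n'(z)/K_n(z)) ≤ 0; equivalently, -Re(K_n'(z)/K_n(z)) ≥ 0. -/
open MeasureTheory

/-- The derivative of the modified Bessel function of the second kind,
`K_ν'(z) = -∫₀^∞ e^{-z cosh t} cosh t cosh(ν t) dt`, for `Re z > 0`. -/
noncomputable def besselK' (ν : ℝ) (z : ℂ) : ℂ :=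
  -∫ t in Set.Ioi (0 : ℝ),
      Complex.exp (-z * Real.cosh t) * (Real.cosh t : ℂ) * (Real.cosh (ν * t) : ℂ)

theorem bk_exp_bound (a m t : ℝ) (ha : 0 < a) (ht : 0 ≤ t) :
    Real.exp (-a * Real.cosh t) * Real.exp (m * t) ≤ Real.exp ((m+1)^2/a) * Real.exp (-t) := by
  rw [← Real.exp_add, ← Real.exp_add]
  apply Real.exp_le_exp.2
  have h1 := Real.quadratic_le_exp_of_nonneg ht
  have h2 : t^2/4 ≤ Real.cosh t := by
    rw [Real.cosh_eq]; have := Real.exp_pos (-t); linarith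
  have h3 : a * (t^2/4) ≤ a * Real.cosh t := by gcongr
  have h4 : (m+1)*t ≤ a * (t^2/4) + (m+1)^2/a := by
    have : a * (t^2/4) + (m+1)^2/a - (m+1)*t = (a*t/2 - (m+1))^2/a := by field_simp; ring
    have h5 : 0 ≤ (a*t/2 - (m+1))^2/a := by positivity
    linarith
  linarith

theorem bk_norm_bound (g : ℝ → ℝ) (m : ℝ) (hg : ∀ t, 0 ≤ t → |g t| ≤ Real.exp (m * t))
    (a : ℝ) (ha : 0 < a) (z : ℂ) (hz : a ≤ z.re) (t : ℝ) (ht : 0 ≤ t) :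
    ‖Complex.exp (-z * Real.cosh t) * (g t : ℂ)‖ ≤ Real.exp ((m+1)^2/a) * Real.exp (-t) := by
  refine le_trans ?_ (bk_exp_bound a m t ha ht)
  rw [norm_mul, Complex.norm_exp, Complex.norm_real, Real.norm_eq_abs]
  have h : (-z * (Real.cosh t : ℂ)).re = -z.re * Real.cosh t := by
    simp only [Complex.re_mul_ofReal, Complex.neg_re]
  rw [h]
  have h0 := Real.cosh_pos t
  have : -z.re * Real.cosh t ≤ -a * Real.cosh t := by nlinarith
  exact mul_le_mul (Real.exp_le_exp.2 this) (hg t ht) (abs_nonneg _) (Real.exp_pos _).le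

theorem bk_dom (C : ℝ) : IntegrableOn (fun t : ℝ => C * Real.exp (-t)) (Set.Ioi 0) :=
  (integrableOn_exp_neg_Ioi 0).const_mul C

theorem bk_meas (g : ℝ → ℝ) (hc : Continuous g) (z : ℂ) :
    AEStronglyMeasurable (fun t : ℝ => Complex.exp (-z * Real.cosh t) * (g t : ℂ))
      (volume.restrict (Set.Ioi 0)) := by
  apply Continuous.aestronglyMeasurable
  have := Real.continuous_cosh
  fun_prop

theorem bk_int (g : ℝ → ℝ) (hc : Continuous g) (m : ℝ)
    (hg : ∀ t, 0 ≤ t → |g t| ≤ Real.exp (m * t)) (z : ℂ) (hz : 0 < z.re) :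
    IntegrableOn (fun t : ℝ => Complex.exp (-z * Real.cosh t) * (g t : ℂ)) (Set.Ioi 0) := by
  refine Integrable.mono' (bk_dom (Real.exp ((m+1)^2/z.re))) (bk_meas g hc z) ?_
  refine (ae_restrict_iff' measurableSet_Ioi).2 (ae_of_all _ fun t ht => ?_)
  exact bk_norm_bound g m hg z.re hz z le_rfl t (le_of_lt ht)

theorem bk_tendsto (g : ℝ → ℝ) (m : ℝ)
    (hg : ∀ t, 0 ≤ t → |g t| ≤ Real.exp (m * t)) (z : ℂ) (hz : 0 < z.re) :
    Filter.Tendsto (fun t : ℝ => Complex.exp (-z * Real.cosh t) * (g t : ℂ)) Filter.atTop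
      (nhds 0) := by
  have h : Filter.Tendsto (fun t : ℝ => Real.exp ((m+1)^2/z.re) * Real.exp (-t)) Filter.atTop
      (nhds 0) := by
    simpa using (Real.tendsto_exp_neg_atTop_nhds_zero.const_mul (Real.exp ((m+1)^2/z.re)))
  refine squeeze_zero_norm' ?_ h
  filter_upwards [Filter.eventually_ge_atTop 0] with t ht
  exact bk_norm_bound g m hg z.re hz z le_rfl t ht

noncomputable def bkF (g : ℝ → ℝ) (z : ℂ) : ℂ :=
  ∫ t in Set.Ioi (0 : ℝ), Complex.exp (-z * Real.cosh t) * (g t : ℂ)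

theorem bk_cosh_le_s1 (t : ℝ) (ht : 0 ≤ t) : |Real.cosh t| ≤ Real.exp t := by
  rw [abs_of_pos (Real.cosh_pos t), Real.cosh_eq]
  have : Real.exp (-t) ≤ Real.exp t := Real.exp_le_exp.2 (by linarith)
  linarith

theorem bk_sinh_le (t : ℝ) (ht : 0 ≤ t) : |Real.sinh t| ≤ Real.exp t := by
  rw [abs_of_nonneg (Real.sinh_nonneg_iff.2 ht), Real.sinh_eq]
  have := Real.exp_pos (-t)
  have := Real.exp_pos t
  linarith

theorem bk_mul_le {g k : ℝ → ℝ} {m l : ℝ}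
    (hg : ∀ t, 0 ≤ t → |g t| ≤ Real.exp (m * t)) (hk : ∀ t, 0 ≤ t → |k t| ≤ Real.exp (l * t)) :
    ∀ t, 0 ≤ t → |g t * k t| ≤ Real.exp ((m + l) * t) := by
  intro t ht
  rw [abs_mul, add_mul, Real.exp_add]
  exact mul_le_mul (hg t ht) (hk t ht) (abs_nonneg _) (Real.exp_pos _).le

theorem bk_hasDeriv (g : ℝ → ℝ) (hc : Continuous g) (m : ℝ)
    (hg : ∀ t, 0 ≤ t → |g t| ≤ Real.exp (m * t)) (z : ℂ) (hz : 0 < z.re) :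
    HasDerivAt (bkF g) (-bkF (fun t => Real.cosh t * g t) z) z := by
  have hcosh : ∀ t : ℝ, 0 ≤ t → |Real.cosh t| ≤ Real.exp (1 * t) := by
    intro t ht; simpa using bk_cosh_le_s1 t ht
  have hg' := bk_mul_le hcosh hg
  have hc' : Continuous fun t => Real.cosh t * g t := Real.continuous_cosh.mul hc
  have hs : {w : ℂ | z.re / 2 < w.re} ∈ nhds z :=
    (isOpen_lt continuous_const Complex.continuous_re).mem_nhds (by simp; linarith)
  have key := (hasDerivAt_integral_of_dominated_loc_of_deriv_le
    (μ := volume.restrict (Set.Ioi (0:ℝ)))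
    (F := fun (w : ℂ) (t : ℝ) => Complex.exp (-w * Real.cosh t) * (g t : ℂ))
    (F' := fun (w : ℂ) (t : ℝ) => -(Complex.exp (-w * Real.cosh t) * ((Real.cosh t * g t : ℝ) : ℂ)))
    (bound := fun t => Real.exp ((1 + m+1)^2/(z.re/2)) * Real.exp (-t))
    hs (Filter.Eventually.of_forall fun w => bk_meas g hc w) (bk_int g hc m hg z hz)
    (bk_meas _ hc' z).neg ?_ (bk_dom _) ?_).2
  · rw [integral_neg] at key
    exact key
  · refine (ae_restrict_iff' measurableSet_Ioi).2 (ae_of_all _ fun t ht w hw => ?_)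
    rw [norm_neg]
    exact bk_norm_bound _ _ hg' _ (by linarith) w (le_of_lt hw) t (le_of_lt ht)
  · refine ae_of_all _ fun t w _ => ?_
    have h1 : HasDerivAt (fun w : ℂ => -w * (Real.cosh t : ℂ)) (-1 * (Real.cosh t : ℂ)) w :=
      (hasDerivAt_id w).neg.mul_const _
    refine (h1.cexp.mul_const (g t : ℂ)).congr_deriv ?_
    push_cast; ring

theorem bk_decay (g : ℝ → ℝ) (m : ℝ)
    (hg : ∀ t, 0 ≤ t → |g t| ≤ Real.exp (m * t)) (z : ℂ) (hz : 0 < z.re) :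
    ∃ C, ∀ r : ℝ, 1 ≤ r → ‖bkF g (r * z)‖ ≤ Real.exp (-(r-1) * z.re) * C := by
  refine ⟨∫ t in Set.Ioi (0 : ℝ), Real.exp ((m+1)^2/z.re) * Real.exp (-t), fun r hr => ?_⟩
  rw [← integral_const_mul]
  refine norm_integral_le_of_norm_le ((bk_dom _).const_mul _) ?_
  refine (ae_restrict_iff' measurableSet_Ioi).2 (ae_of_all _ fun t ht => ?_)
  have h1 := bk_norm_bound g m hg z.re hz z le_rfl t (le_of_lt ht)
  have h2 : Complex.exp (-(r * z) * Real.cosh t) =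
      Complex.exp (-((r-1 : ℝ) * z) * Real.cosh t) * Complex.exp (-z * Real.cosh t) := by
    rw [← Complex.exp_add]; congr 1; push_cast; ring
  rw [h2, mul_assoc, norm_mul]
  refine mul_le_mul ?_ h1 (norm_nonneg _) (Real.exp_pos _).le
  rw [Complex.norm_exp]
  apply Real.exp_le_exp.2
  simp only [Complex.re_mul_ofReal, Complex.neg_re, Complex.re_ofReal_mul]
  have : 0 ≤ (r-1) * z.re := mul_nonneg (by linarith) hz.le
  nlinarith [Real.one_le_cosh t]

theorem bk_ode (n : ℝ) (hn : 0 ≤ n) (z : ℂ) (hz : 0 < z.re) :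
    z^2 * bkF (fun t => Real.cosh t * (Real.cosh t * Real.cosh (n * t))) z
      - z * bkF (fun t => Real.cosh t * Real.cosh (n * t)) z
      - (z^2 + n^2) * bkF (fun t => Real.cosh (n * t)) z = 0 := by
  have hcosh : ∀ t : ℝ, 0 ≤ t → |Real.cosh t| ≤ Real.exp (1 * t) := by
    intro t ht; simpa using bk_cosh_le_s1 t ht
  have hsinh : ∀ t : ℝ, 0 ≤ t → |Real.sinh t| ≤ Real.exp (1 * t) := by
    intro t ht; simpa using bk_sinh_le t ht
  have hcn : ∀ t : ℝ, 0 ≤ t → |Real.cosh (n * t)| ≤ Real.exp (n * t) := by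
    intro t ht; exact bk_cosh_le_s1 _ (by positivity)
  have hsn : ∀ t : ℝ, 0 ≤ t → |Real.sinh (n * t)| ≤ Real.exp (n * t) := by
    intro t ht; exact bk_sinh_le _ (by positivity)
  have c1 := Real.continuous_cosh
  have i0 := bk_int (fun t => Real.cosh (n * t)) (by fun_prop) _ hcn z hz
  have i1 := bk_int (fun t => Real.cosh t * Real.cosh (n * t)) (by fun_prop) _
    (bk_mul_le hcosh hcn) z hz
  have i2 := bk_int (fun t => Real.cosh t * (Real.cosh t * Real.cosh (n * t))) (by fun_prop) _
    (bk_mul_le hcosh (bk_mul_le hcosh hcn)) z hz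
  have l1 := (bk_tendsto _ _ (bk_mul_le hsinh hcn) z hz).const_mul (-z)
  have l2 := (bk_tendsto _ _ hsn z hz).const_mul (n : ℂ)
  have l := l1.sub l2
  have I := ((i2.const_mul (z^2)).sub (i1.const_mul z)).sub (i0.const_mul (z^2+n^2))
  have key := integral_Ioi_of_hasDerivAt_of_tendsto' (a := 0) ?_ I l
  · rw [integral_sub' ((i2.const_mul _).sub (i1.const_mul _)) (i0.const_mul _),
      integral_sub' (i2.const_mul _) (i1.const_mul _), integral_const_mul, integral_const_mul,
      integral_const_mul] at key
    refine Eq.trans key ?_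
    simp
  · intro t _
    have d1 : HasDerivAt (fun t : ℝ => (Real.cosh t : ℂ)) (Real.sinh t : ℂ) t :=
      (Real.hasDerivAt_cosh t).ofReal_comp
    have d2 : HasDerivAt (fun t : ℝ => (Real.sinh t : ℂ)) (Real.cosh t : ℂ) t :=
      (Real.hasDerivAt_sinh t).ofReal_comp
    have dn : HasDerivAt (fun t : ℝ => n * t) n t := by
      simpa using (hasDerivAt_id t).const_mul n
    have d3 := (dn.cosh).ofReal_comp
    have d4 := (dn.sinh).ofReal_comp
    have d5 := (d1.const_mul (-z)).cexp
    have D := ((d5.mul (d2.mul d3)).const_mul (-z)).sub ((d5.mul d4).const_mul (n:ℂ))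
    have hid : (Real.sinh t : ℂ)^2 = (Real.cosh t : ℂ)^2 - 1 := by
      have := Real.cosh_sq t
      rw [← Complex.ofReal_pow, ← Complex.ofReal_pow, this]; push_cast; ring
    convert D using 1
    · funext s; simp
    · simp only [Pi.sub_apply, Pi.mul_apply, Complex.ofReal_mul]
      linear_combination (-z^2 * Complex.exp (-z * Real.cosh t) * (Real.cosh (n*t) : ℂ)) * hid

theorem bk_one_ne (n : ℝ) (hn : 0 ≤ n) : bkF (fun t => Real.cosh (n * t)) 1 ≠ 0 := by
  have hcn : ∀ t : ℝ, 0 ≤ t → |Real.cosh (n * t)| ≤ Real.exp (n * t) := by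
    intro t ht; exact bk_cosh_le_s1 _ (by positivity)
  have c1 := Real.continuous_cosh
  have i0 := bk_int (fun t => Real.cosh (n * t)) (by fun_prop) _ hcn 1 (by simp)
  have e : ∀ t : ℝ, Complex.exp (-1 * Real.cosh t) * (Real.cosh (n * t) : ℂ)
      = ((Real.exp (-Real.cosh t) * Real.cosh (n * t) : ℝ) : ℂ) := by
    intro t; push_cast; congr 2; ring
  simp only [e] at i0
  have i1 : IntegrableOn (fun t : ℝ => Real.exp (-Real.cosh t) * Real.cosh (n * t)) (Set.Ioi 0) := by
    have := i0.re
    simp only [RCLike.re_to_complex, Complex.ofReal_re] at this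
    exact this
  unfold bkF
  simp only [e]
  rw [integral_complex_ofReal]
  have hp : ∀ t : ℝ, 0 < Real.exp (-Real.cosh t) * Real.cosh (n * t) := fun t =>
    mul_pos (Real.exp_pos _) (Real.cosh_pos _)
  have : 0 < ∫ t in Set.Ioi (0:ℝ), Real.exp (-Real.cosh t) * Real.cosh (n * t) := by
    rw [integral_pos_iff_support_of_nonneg (fun t => (hp t).le) i1]
    have : Function.support (fun t : ℝ => Real.exp (-Real.cosh t) * Real.cosh (n * t)) = Set.univ := by
      ext t; simpa using (Real.cosh_pos (n * t)).ne'
    rw [this]; simp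
  exact_mod_cast this.ne'

theorem bk_main (n : ℝ) (hn : 0 ≤ n) (z : ℂ) (hz : 0 < z.re) :
    bkF (fun t => Real.cosh (n * t)) z ≠ 0 ∧
    0 ≤ (bkF (fun t => Real.cosh t * Real.cosh (n * t)) z *
      (starRingEnd ℂ) (bkF (fun t => Real.cosh (n * t)) z)).re := by
  have hcosh : ∀ t : ℝ, 0 ≤ t → |Real.cosh t| ≤ Real.exp (1 * t) := by
    intro t ht; simpa using bk_cosh_le_s1 t ht
  have hcn : ∀ t : ℝ, 0 ≤ t → |Real.cosh (n * t)| ≤ Real.exp (n * t) := by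
    intro t ht; exact bk_cosh_le_s1 _ (by positivity)
  have c1 := Real.continuous_cosh
  have hB := bk_mul_le hcosh hcn
  have dA := bk_hasDeriv (fun t => Real.cosh (n * t)) (by fun_prop) _ hcn
  have dB := bk_hasDeriv (fun t => Real.cosh t * Real.cosh (n * t)) (by fun_prop) _ hB
  obtain ⟨CA, hCA⟩ := bk_decay _ _ hcn z hz
  obtain ⟨CB, hCB⟩ := bk_decay _ _ hB z hz
  have ode := bk_ode n hn
  have hone := bk_one_ne n hn
  set A := bkF (fun t => Real.cosh (n * t)) with hAdef
  set B := bkF (fun t => Real.cosh t * Real.cosh (n * t)) with hBdef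
  set C := bkF (fun t => Real.cosh t * (Real.cosh t * Real.cosh (n * t))) with hCdef
  have hw : ∀ r : ℝ, 0 < r → 0 < ((r : ℂ) * z).re := by
    intro r hr; rw [Complex.re_ofReal_mul]; positivity
  let h : ℝ → ℝ := fun r => r * ((B (r*z)).re * (A (r*z)).re + (B (r*z)).im * (A (r*z)).im)
  let p : ℝ → ℝ := fun r => (r * z + n^2/(r*z) : ℂ).re
  have hp : ∀ r : ℝ, 0 < r → 0 < p r := by
    intro r hr
    have h1 := hw r hr
    have : p r = ((r:ℂ) * z).re + n^2 * (((r:ℂ) * z).re / Complex.normSq (r*z)) := by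
      simp only [p]
      rw [Complex.add_re, div_eq_mul_inv, ← Complex.ofReal_pow, Complex.re_ofReal_mul (n^2),
        Complex.inv_re]
    rw [this]
    have : 0 ≤ Complex.normSq (r*z) := Complex.normSq_nonneg _
    positivity
  have hd : ∀ r : ℝ, 0 < r → HasDerivAt h
      (-(p r * Complex.normSq (A (r*z)) + r * z.re * Complex.normSq (B (r*z)))) r := by
    intro r hr
    have hz0 : (r:ℂ) * z ≠ 0 := by
      intro h0; have := hw r hr; rw [h0] at this; simp at this
    have dl : HasDerivAt (fun r : ℝ => (r:ℂ) * z) z r := by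
      simpa using (hasDerivAt_id r).ofReal_comp.mul_const z
    have a1 : HasDerivAt (fun r : ℝ => A (r*z)) (-B (r*z) * z) r :=
      HasDerivAt.comp r (dA _ (hw r hr)) dl
    have b1 : HasDerivAt (fun r : ℝ => B (r*z)) (-C (r*z) * z) r :=
      HasDerivAt.comp r (dB _ (hw r hr)) dl
    have are : HasDerivAt (fun r : ℝ => (A (r*z)).re) (-B (r*z) * z).re r :=
      Complex.reCLM.hasFDerivAt.comp_hasDerivAt r a1
    have aim : HasDerivAt (fun r : ℝ => (A (r*z)).im) (-B (r*z) * z).im r :=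
      Complex.imCLM.hasFDerivAt.comp_hasDerivAt r a1
    have bre : HasDerivAt (fun r : ℝ => (B (r*z)).re) (-C (r*z) * z).re r :=
      Complex.reCLM.hasFDerivAt.comp_hasDerivAt r b1
    have bim : HasDerivAt (fun r : ℝ => (B (r*z)).im) (-C (r*z) * z).im r :=
      Complex.imCLM.hasFDerivAt.comp_hasDerivAt r b1
    have o := ode _ (hw r hr)
    have o2 : B (r*z) + r * (-C (r*z) * z) = -((r*z + n^2/(r*z)) * A (r*z)) := by
      apply mul_left_cancel₀ hz0
      have : (r*z : ℂ) * -((r*z + n^2/(r*z)) * A (r*z)) = -(((r*z)^2 + n^2) * A (r*z)) := by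
        have : (r*z : ℂ) * (n^2/(r*z)) = n^2 := mul_div_cancel₀ _ hz0
        linear_combination (-A (r*z)) * this
      rw [this]
      linear_combination -o
    have ore := congrArg Complex.re o2
    have oim := congrArg Complex.im o2
    rw [Complex.add_re, Complex.re_ofReal_mul, Complex.neg_re, Complex.mul_re (_ + _)] at ore
    rw [Complex.add_im, Complex.im_ofReal_mul, Complex.neg_im, Complex.mul_im (_ + _)] at oim
    have D := (hasDerivAt_id r).mul ((bre.mul are).add (bim.mul aim))
    refine D.congr_deriv ?_
    simp only [Pi.add_apply, Pi.mul_apply, id]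
    have e1 : (-B (r*z) * z).re = -((B (r*z)).re * z.re - (B (r*z)).im * z.im) := by simp
    have e2 : (-B (r*z) * z).im = -((B (r*z)).re * z.im + (B (r*z)).im * z.re) := by simp
    rw [e1, e2, Complex.normSq_apply, Complex.normSq_apply]
    simp only [p]
    linear_combination (A (r*z)).re * ore + (A (r*z)).im * oim
  have hneg : ∀ r : ℝ, 0 < r →
      -(p r * Complex.normSq (A (r*z)) + r * z.re * Complex.normSq (B (r*z))) ≤ 0 := by
    intro r hr
    have := hp r hr
    have h1 : 0 ≤ Complex.normSq (A (r*z)) := Complex.normSq_nonneg _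
    have h2 : 0 ≤ Complex.normSq (B (r*z)) := Complex.normSq_nonneg _
    have : 0 ≤ p r * Complex.normSq (A (r*z)) + r * z.re * Complex.normSq (B (r*z)) := by positivity
    linarith
  have hanti : AntitoneOn h (Set.Ioi 0) := by
    refine antitoneOn_of_hasDerivWithinAt_nonpos (convex_Ioi 0)
      (f' := fun r => -(p r * Complex.normSq (A (r*z)) + r * z.re * Complex.normSq (B (r*z))))
      (fun r hr => (hd r hr).continuousAt.continuousWithinAt) ?_ ?_
    · intro r hr; rw [interior_Ioi] at hr ⊢; exact (hd r hr).hasDerivWithinAt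
    · intro r hr; rw [interior_Ioi] at hr; exact hneg r hr
  have heq : ∀ r, h r = r * (B (r*z) * (starRingEnd ℂ) (A (r*z))).re := by
    intro r; simp [h, Complex.mul_re]
  have hlim : Filter.Tendsto h Filter.atTop (nhds 0) := by
    have hl : Filter.Tendsto (fun r : ℝ => (r * Real.exp (-z.re * r)) * (Real.exp z.re * CB * CA))
        Filter.atTop (nhds 0) := by
      have := (tendsto_rpow_mul_exp_neg_mul_atTop_nhds_zero 1 z.re hz).mul_const
        (Real.exp z.re * CB * CA)
      simpa using this
    refine squeeze_zero_norm' ?_ hl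
    filter_upwards [Filter.eventually_ge_atTop 1] with r hr
    have ha := hCA r hr
    have hb := hCB r hr
    have hex : Real.exp (-(r-1) * z.re) = Real.exp (-z.re * r) * Real.exp z.re := by
      rw [← Real.exp_add]; congr 1; ring
    have hle : Real.exp (-(r-1) * z.re) ≤ 1 := by
      apply Real.exp_le_one_iff.2; nlinarith
    have hCA0 : 0 ≤ CA := by
      by_contra hh
      have := norm_nonneg (A (r*z))
      have := Real.exp_pos (-(r-1) * z.re)
      nlinarith
    have ha' : ‖A (r*z)‖ ≤ CA := ha.trans (by nlinarith)
    rw [heq, norm_mul, Real.norm_eq_abs, Real.norm_eq_abs, abs_of_nonneg (by linarith : 0 ≤ r)]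
    calc r * |(B (r*z) * (starRingEnd ℂ) (A (r*z))).re| ≤ r * (‖B (r*z)‖ * ‖A (r*z)‖) := by
          gcongr
          refine (Complex.abs_re_le_norm _).trans ?_
          rw [norm_mul, RCLike.norm_conj]
      _ ≤ r * ((Real.exp (-(r-1) * z.re) * CB) * CA) := by
          gcongr
          exact (norm_nonneg _).trans hb
      _ = _ := by rw [hex]; ring
  have hnn : ∀ r, 0 < r → 0 ≤ h r := by
    intro r hr
    refine le_of_tendsto hlim ?_
    filter_upwards [Filter.eventually_ge_atTop r] with s hs
    exact hanti hr (lt_of_lt_of_le hr hs) hs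
  have h1 := hnn 1 one_pos
  rw [heq] at h1
  simp only [Complex.ofReal_one, one_mul] at h1
  refine ⟨fun hA0 => ?_, h1⟩
  have hh1 : h 1 = 0 := by rw [heq]; simp [hA0]
  have hzero : ∀ r : ℝ, 1 < r → h r = 0 := by
    intro r hr
    have := hanti (Set.mem_Ioi.2 one_pos) (Set.mem_Ioi.2 (by linarith : (0:ℝ) < r)) hr.le
    have := hnn r (by linarith)
    linarith
  have hAz : ∀ r : ℝ, 1 < r → A (r*z) = 0 := by
    intro r hr
    have hr0 : 0 < r := by linarith
    have e : h =ᶠ[nhds r] fun _ => (0:ℝ) := by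
      filter_upwards [lt_mem_nhds hr] with s hs using hzero s hs
    have d0 := ((hasDerivAt_const r (0:ℝ)).congr_of_eventuallyEq e).unique (hd r hr0)
    have := hp r hr0
    have n1 : 0 ≤ Complex.normSq (A (r*z)) := Complex.normSq_nonneg _
    have n2 : 0 ≤ Complex.normSq (B (r*z)) := Complex.normSq_nonneg _
    have n3 : 0 ≤ r * z.re * Complex.normSq (B (r*z)) := by positivity
    have n4 : 0 ≤ p r * Complex.normSq (A (r*z)) := by positivity
    have n5 : p r * Complex.normSq (A (r*z)) = 0 := by linarith
    rcases mul_eq_zero.1 n5 with h0 | h0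
    · linarith
    · exact Complex.normSq_eq_zero.1 h0
  have hopen : IsOpen {w : ℂ | 0 < w.re} := isOpen_lt continuous_const Complex.continuous_re
  have han : AnalyticOnNhd ℂ A {w : ℂ | 0 < w.re} :=
    DifferentiableOn.analyticOnNhd
      (fun w hw => (dA w hw).differentiableAt.differentiableWithinAt) hopen
  have hconn : IsPreconnected {w : ℂ | 0 < w.re} := (convex_halfSpace_re_gt 0).isPreconnected
  have hz0 : z ≠ 0 := by rintro rfl; simp at hz
  have htend : Filter.Tendsto (fun r : ℝ => (r:ℂ) * z) (nhdsWithin 2 (Set.Ioi 2))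
      (nhdsWithin ((2:ℝ) * z) {(2:ℝ) * z}ᶜ) := by
    refine tendsto_nhdsWithin_iff.2 ⟨?_, ?_⟩
    · have : Continuous (fun r : ℝ => (r:ℂ) * z) := by fun_prop
      exact this.continuousAt.tendsto.mono_left nhdsWithin_le_nhds
    · filter_upwards [self_mem_nhdsWithin] with r hr hh
      have := mul_right_cancel₀ hz0 hh
      have := Complex.ofReal_injective this
      exact absurd this (ne_of_gt hr)
  have hfreq : ∃ᶠ w in nhdsWithin ((2:ℝ) * z) {(2:ℝ) * z}ᶜ, A w = 0 := by
    refine htend.frequently (Filter.Eventually.frequently ?_)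
    filter_upwards [self_mem_nhdsWithin] with r hr
    exact hAz r (by have : (2:ℝ) < r := hr; linarith)
  have := han.eqOn_zero_of_preconnected_of_frequently_eq_zero hconn (hw 2 two_pos) hfreq
  exact hone (this (show (0:ℝ) < (1:ℂ).re by simp))

/-- For an integer `n ≥ 1` and `z ∈ ℂ` with `Re z > 0`, one has `K_n(z) ≠ 0` and
`Re (K_n'(z)/K_n(z)) ≤ 0` (equivalently, `-Re (K_n'(z)/K_n(z)) ≥ 0`). -/
theorem besselK_ne_zero_and_re_ratio_nonpos (n : ℕ) (hn : 1 ≤ n) (z : ℂ) (hz : 0 < z.re) :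
    besselK (n : ℝ) z ≠ 0 ∧ (besselK' (n : ℝ) z / besselK (n : ℝ) z).re ≤ 0 := by
  obtain ⟨h1, h2⟩ := bk_main (n : ℝ) (Nat.cast_nonneg n) z hz
  have e1 : besselK (n : ℝ) z = bkF (fun t => Real.cosh (n * t)) z := rfl
  have e2 : besselK' (n : ℝ) z = -bkF (fun t => Real.cosh t * Real.cosh (n * t)) z := by
    unfold besselK' bkF
    congr 2
    funext t
    push_cast; ring
  rw [e1, e2]
  refine ⟨h1, ?_⟩
  rw [div_eq_mul_inv, Complex.inv_def, ← mul_assoc, Complex.re_mul_ofReal, neg_mul,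
    Complex.neg_re]
  have : 0 ≤ (Complex.normSq (bkF (fun t => Real.cosh (n * t)) z))⁻¹ :=
    inv_nonneg.2 (Complex.normSq_nonneg _)
  nlinarith [mul_nonneg h2 this]
end

section
/- Let n ≥ 1 be an integer and let z be a complex number with Re z > 0. Then |K_{n-1}(z)| ≤ |K_n(z)|. -/
open MeasureTheory

lemma bK_cosh_lower (s : ℝ) : 1 + s ^ 2 / 2 ≤ Real.cosh s := by
  have h : Real.cosh s = 2 * Real.sinh (s / 2) ^ 2 + 1 := by
    have := Real.cosh_two_mul (s / 2)
    rw [show 2 * (s / 2) = s by ring, Real.cosh_sq] at this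
    linarith
  have h2 : |s / 2| ≤ Real.sinh |s / 2| := Real.self_le_sinh_iff.2 (abs_nonneg _)
  rw [← Real.abs_sinh] at h2
  have h3 := sq_le_sq.2 h2
  rw [h]; nlinarith

lemma bK_int (a ν : ℝ) (ha : 0 < a) :
    Integrable (fun s : ℝ => Real.exp (-a * Real.cosh s + ν * s)) := by
  have h := (integrable_cexp_quadratic (b := ((a / 2 : ℝ) : ℂ)) (by simpa using ha) (ν : ℂ) 0).norm
  refine h.mono' (by fun_prop) (ae_of_all _ fun s => ?_)
  rw [Complex.norm_exp, Real.norm_eq_abs, abs_of_pos (Real.exp_pos _)]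
  refine Real.exp_le_exp.2 ?_
  have h1 := mul_le_mul_of_nonneg_left (bK_cosh_lower s) ha.le
  have : (-((a / 2 : ℝ) : ℂ) * (s : ℂ) ^ 2 + (ν : ℂ) * s + 0) = ((-(a / 2) * s ^ 2 + ν * s : ℝ) : ℂ) := by
    push_cast; ring
  rw [this, Complex.ofReal_re]
  nlinarith

lemma bK_int_cosh (a : ℝ) (ha : 0 < a) :
    Integrable (fun s : ℝ => Real.cosh s * Real.exp (-a * Real.cosh s)) := by
  have := ((bK_int a 1 ha).add (bK_int a (-1) ha)).div_const 2
  refine this.congr (ae_of_all _ fun s => ?_)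
  simp only [Pi.add_apply, Real.exp_add]
  rw [Real.cosh_eq]
  ring_nf

lemma bK_cosh_re (v φ : ℝ) : (Complex.cosh (v + φ * Complex.I)) =
    (Real.cosh v * Real.cos φ : ℝ) + (Real.sinh v * Real.sin φ : ℝ) * Complex.I := by
  rw [Complex.cosh_add, Complex.cosh_mul_I, Complex.sinh_mul_I]
  push_cast; ring

lemma bK_sinh_norm (v φ : ℝ) : ‖Complex.sinh (v + φ * Complex.I)‖ ≤ Real.cosh v := by
  refine abs_le_of_sq_le_sq' ?_ (Real.cosh_pos v).le |>.2
  rw [Complex.sinh_add, Complex.cosh_mul_I, Complex.sinh_mul_I, ← mul_assoc, ← Complex.ofReal_sinh, ← Complex.ofReal_cosh, ← Complex.ofReal_sin,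
    ← Complex.ofReal_cos, ← Complex.ofReal_mul, ← Complex.ofReal_mul, Complex.sq_norm,
    Complex.normSq_add_mul_I]
  have h1 := Real.cosh_sq v
  have h2 := Real.sin_sq_add_cos_sq φ
  nlinarith [sq_nonneg (Real.cos φ), sq_nonneg (Real.sin φ)]

lemma bK_exp_norm (A v φ : ℝ) : ‖Complex.exp (-A * Complex.cosh (v + φ * Complex.I))‖ =
    Real.exp (-(A * Real.cos φ) * Real.cosh v) := by
  rw [Complex.norm_exp, bK_cosh_re]
  congr 1
  rw [← Complex.ofReal_neg, Complex.re_ofReal_mul, Complex.add_re, Complex.re_ofReal_mul,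
    Complex.ofReal_re, Complex.I_re]
  ring

lemma bK_const (A : ℝ) (hA : 0 < A) (φ : ℝ) (hφ : |φ| < Real.pi / 2) :
    ∫ v : ℝ, Complex.exp (-A * Complex.cosh (v + φ * Complex.I)) =
    ∫ v : ℝ, Complex.exp (-A * Complex.cosh (v + (0 : ℝ) * Complex.I)) := by
  have hint : ∀ x : ℝ, 0 < Real.cos x →
      Integrable (fun v : ℝ => Complex.exp (-A * Complex.cosh (v + x * Complex.I))) := by
    intro x hx
    refine (bK_int (A * Real.cos x) 0 (by positivity)).mono' (by fun_prop) (ae_of_all _ fun v => ?_)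
    rw [bK_exp_norm]; simp
  have key : ∀ x : ℝ, 0 < Real.cos x →
      HasDerivAt (fun φ : ℝ => ∫ v : ℝ, Complex.exp (-A * Complex.cosh (v + φ * Complex.I))) 0 x := by
    intro x hx
    have main := hasDerivAt_integral_of_dominated_loc_of_deriv_le (μ := (volume : Measure ℝ))
      (F := fun (φ : ℝ) (v : ℝ) => Complex.exp (-A * Complex.cosh (v + φ * Complex.I)))
      (F' := fun (φ : ℝ) (v : ℝ) => Complex.exp (-A * Complex.cosh (v + φ * Complex.I)) *
        (-A * (Complex.sinh (v + φ * Complex.I) * Complex.I)))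
      (bound := fun v => A * (Real.cosh v * Real.exp (-(A * (Real.cos x / 2)) * Real.cosh v)))
      (s := {φ : ℝ | Real.cos x / 2 < Real.cos φ}) (x₀ := x)
      ((isOpen_lt continuous_const Real.continuous_cos).mem_nhds (by simp; linarith))
      (Filter.Eventually.of_forall fun φ => by fun_prop)
      (hint x hx) (by fun_prop)
      (ae_of_all _ fun v φ hφ => by
        rw [norm_mul, bK_exp_norm, norm_mul, norm_mul, Complex.norm_I, norm_neg, Complex.norm_real,
          Real.norm_eq_abs, abs_of_pos hA, mul_one]
        have h1 := bK_sinh_norm v φ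
        have h2 : Real.exp (-(A * Real.cos φ) * Real.cosh v) ≤
            Real.exp (-(A * (Real.cos x / 2)) * Real.cosh v) := by
          refine Real.exp_le_exp.2 ?_
          have : A * (Real.cos x / 2) * Real.cosh v ≤ A * Real.cos φ * Real.cosh v := by
            have := Real.cosh_pos v
            have h3 : Real.cos x / 2 < Real.cos φ := hφ
            gcongr
          linarith
        calc _ ≤ Real.exp (-(A * (Real.cos x / 2)) * Real.cosh v) * (A * Real.cosh v) := by gcongr
          _ = _ := by ring)
      ((bK_int_cosh _ (by positivity)).const_mul A)
      (ae_of_all _ fun v φ _ => by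
        have h1 : HasDerivAt (fun φ : ℝ => (v : ℂ) + φ * Complex.I) Complex.I φ := by
          simpa using ((Complex.ofRealCLM.hasDerivAt (x := φ)).mul_const Complex.I).const_add (v : ℂ)
        exact (((Complex.hasDerivAt_cosh _).comp φ h1).const_mul (-A : ℂ)).cexp)
    have hz : ∫ v : ℝ, Complex.exp (-A * Complex.cosh (v + x * Complex.I)) *
        (-A * (Complex.sinh (v + x * Complex.I) * Complex.I)) = 0 := by
      refine integral_eq_zero_of_hasDerivAt_of_integrable (f := fun v : ℝ =>
        Complex.I * Complex.exp (-A * Complex.cosh (v + x * Complex.I))) ?_ main.1 ((hint x hx).const_mul _)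
      intro v
      have h1 : HasDerivAt (fun v : ℝ => (v : ℂ) + x * Complex.I) 1 v := by
        simpa using ((Complex.ofRealCLM.hasDerivAt (x := v))).add_const (x * Complex.I : ℂ)
      have := ((((Complex.hasDerivAt_cosh _).comp v h1).const_mul (-A : ℂ)).cexp).const_mul Complex.I
      refine this.congr_deriv ?_
      simp only [Function.comp_apply]
      ring
    rw [hz] at main
    exact main.2
  have hcos : ∀ x ∈ Set.Ioo (-(Real.pi / 2)) (Real.pi / 2), 0 < Real.cos x :=
    fun x hx => Real.cos_pos_of_mem_Ioo hx
  exact isOpen_Ioo.is_const_of_deriv_eq_zero (𝕜 := ℝ) (s := Set.Ioo (-(Real.pi / 2)) (Real.pi / 2))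
    (f := fun φ : ℝ => ∫ v : ℝ, Complex.exp (-A * Complex.cosh (v + φ * Complex.I)))
    isPreconnected_Ioo
    (fun x hx => (key x (hcos x hx)).differentiableAt.differentiableWithinAt)
    (fun x hx => (key x (hcos x hx)).deriv) (abs_lt.1 hφ)
    ⟨by linarith [Real.pi_pos], by linarith [Real.pi_pos]⟩

lemma bK_pos (a b : ℝ) (ha : 0 < a) : ∃ r : ℝ, 0 ≤ r ∧
    ∫ v : ℝ, Complex.exp (-(a * Real.cosh v + b * Real.sinh v * Complex.I)) = (r : ℂ) := by
  set c : ℂ := ⟨a, b⟩ with hc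
  have hc0 : c ≠ 0 := fun h => by
    have := congrArg Complex.re h
    simp [hc] at this; linarith
  have h1 : ‖c‖ * Real.cos c.arg = a := Complex.norm_mul_cos_arg c
  have h2 : ‖c‖ * Real.sin c.arg = b := Complex.norm_mul_sin_arg c
  have h := bK_const ‖c‖ (norm_pos_iff.2 hc0) c.arg (Complex.abs_arg_lt_pi_div_two_iff.2 (Or.inl ha))
  refine ⟨∫ v : ℝ, Real.exp (-‖c‖ * Real.cosh v), integral_nonneg fun v => (Real.exp_pos _).le, ?_⟩
  rw [← integral_complex_ofReal]
  refine (integral_congr_ae (ae_of_all _ fun v => ?_)).trans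
    (h.trans (integral_congr_ae (ae_of_all _ fun v => ?_)))
  · try dsimp only
    congr 1
    rw [bK_cosh_re]
    rw [← h1, ← h2]
    push_cast; ring
  · dsimp only
    rw [Complex.ofReal_exp]; congr 1; simp

lemma bK_integrable (ν : ℝ) (z : ℂ) (hz : 0 < z.re) :
    Integrable (fun s : ℝ => Complex.exp (-z * Real.cosh s + ν * s)) := by
  refine (bK_int z.re ν hz).mono' (by fun_prop) (ae_of_all _ fun s => ?_)
  rw [Complex.norm_exp, Complex.add_re, Complex.re_mul_ofReal, Complex.re_mul_ofReal]
  simp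

lemma bK_two_mul (ν : ℝ) (z : ℂ) (hz : 0 < z.re) :
    ∫ s : ℝ, Complex.exp (-z * Real.cosh s + ν * s) = 2 * besselK ν z := by
  have hi := bK_integrable ν z hz
  have hi' := hi.comp_neg
  rw [← intervalIntegral.integral_Iic_add_Ioi hi.integrableOn (b := 0) hi.integrableOn]
  have := integral_comp_neg_Ioi 0 (fun s : ℝ => Complex.exp (-z * Real.cosh s + ν * s))
  rw [neg_zero] at this
  rw [← this, ← integral_add hi'.integrableOn hi.integrableOn, besselK, ← integral_const_mul]
  refine integral_congr_ae (ae_of_all _ fun s => ?_)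
  simp only [Real.cosh_neg, Complex.exp_add, Complex.ofReal_cosh (ν * s)]
  rw [Complex.cosh]
  push_cast
  ring_nf

lemma bK_conj (ν : ℝ) (z : ℂ) :
    besselK ν ((starRingEnd ℂ) z) = (starRingEnd ℂ) (besselK ν z) := by
  rw [besselK, besselK, ← integral_conj]
  refine integral_congr_ae (ae_of_all _ fun s => ?_)
  simp only [map_mul, ← Complex.exp_conj, map_neg, Complex.conj_ofReal]

lemma bK_kernel (z : ℂ) (hz : 0 < z.re) (x : ℝ) : ∃ r : ℝ, 0 ≤ r ∧
    ∫ t : ℝ, Complex.exp (-z * Real.cosh t - (starRingEnd ℂ) z * Real.cosh (x - t)) = (r : ℂ) := by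
  obtain ⟨r, hr, h⟩ := bK_pos (2 * z.re * Real.cosh (x / 2)) (2 * z.im * Real.sinh (x / 2))
    (by have := Real.cosh_pos (x / 2); positivity)
  refine ⟨r, hr, ?_⟩
  rw [← h, ← integral_add_left_eq_self _ (x / 2)]
  refine integral_congr_ae (ae_of_all _ fun v => ?_)
  dsimp only
  rw [show x - (x / 2 + v) = x / 2 - v by ring, Real.cosh_add, Real.cosh_sub]
  congr 1
  have hz1 : z = z.re + z.im * Complex.I := (Complex.re_add_im z).symm
  have hz2 : (starRingEnd ℂ) z = z.re - z.im * Complex.I := by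
    apply Complex.ext <;> simp
  rw [hz2]
  nth_rewrite 1 [hz1]
  push_cast
  ring

lemma bK_repr (z : ℂ) (hz : 0 < z.re) : ∃ h : ℝ → ℝ, (∀ x, 0 ≤ h x) ∧ ∀ ν : ℝ,
    Integrable (fun x : ℝ => Real.exp (ν * x) * h x) ∧
    ∫ x : ℝ, Real.exp (ν * x) * h x = 4 * ‖besselK ν z‖ ^ 2 := by
  choose h h0 hh using bK_kernel z hz
  refine ⟨h, h0, fun ν => ?_⟩
  have hz' : 0 < ((starRingEnd ℂ) z).re := by simpa using hz
  have hf := bK_integrable ν z hz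
  have hg := bK_integrable ν _ hz'
  have hc : (fun x : ℝ => ((Real.exp (ν * x) * h x : ℝ) : ℂ)) =
      convolution (fun s : ℝ => Complex.exp (-z * Real.cosh s + ν * s))
        (fun s : ℝ => Complex.exp (-(starRingEnd ℂ) z * Real.cosh s + ν * s))
        (ContinuousLinearMap.mul ℝ ℂ) volume := by
    funext x
    rw [convolution_def, Complex.ofReal_mul, ← hh, ← integral_const_mul]
    refine integral_congr_ae (ae_of_all _ fun t => ?_)
    simp only [ContinuousLinearMap.mul_apply']
    rw [Complex.ofReal_exp, ← Complex.exp_add, ← Complex.exp_add]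
    congr 1
    push_cast
    ring
  have h1 : Integrable (fun x : ℝ => ((Real.exp (ν * x) * h x : ℝ) : ℂ)) := by
    rw [hc]; exact hf.integrable_convolution _ hg
  have h2 : ∫ x : ℝ, ((Real.exp (ν * x) * h x : ℝ) : ℂ) = ((4 * ‖besselK ν z‖ ^ 2 : ℝ) : ℂ) := by
    rw [hc, integral_convolution _ hf hg, bK_two_mul ν z hz, bK_two_mul ν _ hz', bK_conj]
    simp only [ContinuousLinearMap.mul_apply']
    have := Complex.mul_conj' (besselK ν z)
    push_cast
    rw [← this]; ring
  refine ⟨h1.re.congr (ae_of_all _ fun x => Complex.ofReal_re _), ?_⟩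
  rw [integral_complex_ofReal] at h2
  exact_mod_cast h2

lemma bK_neg (ν : ℝ) (z : ℂ) : besselK (-ν) z = besselK ν z := by
  simp only [besselK, neg_mul ν, Real.cosh_neg]

lemma bK_mono (ν μ : ℝ) (hνμ : |ν| ≤ |μ|) (z : ℂ) (hz : 0 < z.re) :
    ‖besselK ν z‖ ≤ ‖besselK μ z‖ := by
  obtain ⟨h, h0, hh⟩ := bK_repr z hz
  have key : ∀ ν : ℝ, Integrable (fun x : ℝ => Real.cosh (ν * x) * h x) ∧
      ∫ x : ℝ, Real.cosh (ν * x) * h x = 4 * ‖besselK ν z‖ ^ 2 := by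
    intro ν
    obtain ⟨i1, e1⟩ := hh ν
    obtain ⟨i2, e2⟩ := hh (-ν)
    have he : (fun x : ℝ => Real.cosh (ν * x) * h x) =
        fun x => (Real.exp (ν * x) * h x + Real.exp (-ν * x) * h x) / 2 := by
      funext x; rw [Real.cosh_eq]; ring_nf
    rw [he]
    refine ⟨(i1.add i2).div_const 2, ?_⟩
    rw [integral_div, integral_add i1 i2, e1, e2, bK_neg]; ring
  have hle : ∫ x : ℝ, Real.cosh (ν * x) * h x ≤ ∫ x : ℝ, Real.cosh (μ * x) * h x := by
    refine integral_mono (key ν).1 (key μ).1 fun x => ?_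
    refine mul_le_mul_of_nonneg_right (Real.cosh_le_cosh.2 ?_) (h0 x)
    rw [abs_mul, abs_mul]; gcongr
  rw [(key ν).2, (key μ).2] at hle
  exact (sq_le_sq₀ (norm_nonneg _) (norm_nonneg _)).1 (by linarith)

/-- For an integer `n ≥ 1` and `z ∈ ℂ` with `Re z > 0`, `|K_{n-1}(z)| ≤ |K_n(z)|`. -/
theorem abs_besselK_le_abs_besselK_succ (n : ℕ) (hn : 1 ≤ n) (z : ℂ) (hz : 0 < z.re) :
    ‖besselK ((n : ℝ) - 1) z‖ ≤ ‖besselK (n : ℝ) z‖ := by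
  have h1 : (1 : ℝ) ≤ n := by exact_mod_cast hn
  refine bK_mono _ _ ?_ z hz
  rw [abs_of_nonneg (by linarith), abs_of_nonneg (by linarith)]
  linarith
end

section
/- Let n ≥ 1 be an integer and let z be a complex number with Re z > 0. Then |K_n'(z)| ≤ (n/|z| + 1)·|K_n(z)|. -/
open MeasureTheory

namespace BesselAux

lemma sq_le_cosh (s : ℝ) : s ^ 2 / 4 ≤ Real.cosh s := by
  have h := Real.quadratic_le_exp_of_nonneg (abs_nonneg s)
  have h2 := Real.exp_pos (-|s|)
  rw [← Real.cosh_abs, Real.cosh_eq]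
  have := abs_nonneg s
  have h3 := sq_abs s
  linarith

lemma cosh_le_exp_abs (s : ℝ) : Real.cosh s ≤ Real.exp |s| := by
  rw [← Real.cosh_abs, Real.cosh_eq]
  have : Real.exp (-|s|) ≤ Real.exp |s| :=
    Real.exp_le_exp.2 (by have := abs_nonneg s; linarith)
  linarith

lemma abs_sinh_le_exp_abs (s : ℝ) : |Real.sinh s| ≤ Real.exp |s| := by
  refine le_trans ?_ (cosh_le_exp_abs s)
  rw [Real.abs_sinh, ← Real.cosh_abs]
  exact (Real.sinh_lt_cosh _).le

lemma integrable_bound (x p : ℝ) (hx : 0 < x) :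
    Integrable (fun s : ℝ => Real.exp (-x * Real.cosh s) * Real.exp (p * |s|)) := by
  have h1 : Integrable (fun s : ℝ => Real.exp (2 * p ^ 2 / x) * Real.exp (-(x / 8) * s ^ 2)) :=
    (integrable_exp_neg_mul_sq (by positivity)).const_mul _
  refine h1.mono' (by fun_prop) (Filter.Eventually.of_forall fun s => ?_)
  rw [Real.norm_of_nonneg (by positivity), ← Real.exp_add, ← Real.exp_add]
  apply Real.exp_le_exp.2
  have h2 := mul_le_mul_of_nonneg_left (sq_le_cosh s) hx.le
  have h3 : 0 ≤ (x * |s| - 4 * p) ^ 2 / (8 * x) := by positivity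
  have h4 : (x * |s| - 4 * p) ^ 2 / (8 * x) = x * s ^ 2 / 8 - p * |s| + 2 * p ^ 2 / x := by
    rw [← sq_abs s]; field_simp; ring
  linarith

lemma integrable_of_bound {h : ℝ → ℂ} (hc : Continuous h) (C x p : ℝ) (hx : 0 < x)
    (hb : ∀ s, ‖h s‖ ≤ C * (Real.exp (-x * Real.cosh s) * Real.exp (p * |s|))) :
    Integrable h :=
  ((integrable_bound x p hx).const_mul C).mono' hc.aestronglyMeasurable
    (Filter.Eventually.of_forall hb)

lemma norm_exp_cosh (z : ℂ) (s : ℝ) :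
    ‖Complex.exp (-z * (Real.cosh s : ℝ))‖ = Real.exp (-z.re * Real.cosh s) := by
  rw [Complex.norm_exp, Complex.re_mul_ofReal, Complex.neg_re]

lemma continuous_exp_cosh (z : ℂ) :
    Continuous fun s : ℝ => Complex.exp (-z * (Real.cosh s : ℝ)) := by
  have : Continuous fun s : ℝ => ((Real.cosh s : ℝ) : ℂ) :=
    Complex.continuous_ofReal.comp Real.continuous_cosh
  fun_prop

/-- integrability against a real weight of exponential growth -/
lemma integrable_weight (z : ℂ) (hz : 0 < z.re) (w : ℝ → ℝ) (hw : Continuous w) (p : ℝ)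
    (hb : ∀ s, |w s| ≤ Real.exp (p * |s|)) :
    Integrable fun s : ℝ => Complex.exp (-z * (Real.cosh s : ℝ)) * (w s : ℂ) := by
  refine integrable_of_bound ((continuous_exp_cosh z).mul (Complex.continuous_ofReal.comp hw))
    1 z.re p hz fun s => ?_
  rw [norm_mul, norm_exp_cosh, Complex.norm_real, Real.norm_eq_abs, one_mul]
  exact mul_le_mul_of_nonneg_left (hb s) (Real.exp_pos _).le

lemma integral_even {h : ℝ → ℂ} (hi : Integrable h) (he : ∀ s, h (-s) = h s) :
    ∫ s, h s = 2 * ∫ s in Set.Ioi (0 : ℝ), h s := by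
  rw [← integral_add_compl (measurableSet_Ioi (a := (0 : ℝ))) hi, Set.compl_Ioi]
  have := integral_comp_neg_Iic (0 : ℝ) h
  simp only [he, neg_zero] at this
  rw [this]; ring

lemma abs_cosh_mul_le (ν s : ℝ) : |Real.cosh (ν * s)| ≤ Real.exp (|ν| * |s|) := by
  rw [abs_of_pos (Real.cosh_pos _), ← abs_mul]; exact cosh_le_exp_abs _

lemma abs_sinh_mul_le (ν s : ℝ) : |Real.sinh (ν * s)| ≤ Real.exp (|ν| * |s|) := by
  rw [← abs_mul]; exact abs_sinh_le_exp_abs _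

lemma int_cosh (ν : ℝ) (z : ℂ) (hz : 0 < z.re) :
    Integrable fun s : ℝ => Complex.exp (-z * (Real.cosh s : ℝ)) * (Real.cosh (ν * s) : ℂ) :=
  integrable_weight z hz (fun s => Real.cosh (ν * s))
    (Real.continuous_cosh.comp (by fun_prop)) |ν| (abs_cosh_mul_le ν)

lemma int_sinh (ν : ℝ) (z : ℂ) (hz : 0 < z.re) :
    Integrable fun s : ℝ => Complex.exp (-z * (Real.cosh s : ℝ)) * (Real.sinh (ν * s) : ℂ) :=
  integrable_weight z hz (fun s => Real.sinh (ν * s))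
    (Real.continuous_sinh.comp (by fun_prop)) |ν| (abs_sinh_mul_le ν)

lemma int_exp (ν : ℝ) (z : ℂ) (hz : 0 < z.re) :
    Integrable fun s : ℝ => Complex.exp (-z * (Real.cosh s : ℝ)) * (Real.exp (ν * s) : ℂ) :=
  integrable_weight z hz (fun s => Real.exp (ν * s)) (by fun_prop) |ν| (fun s => by
    rw [abs_of_pos (Real.exp_pos _), ← abs_mul]; exact Real.exp_le_exp.2 (le_abs_self _))

lemma int_sinh_sinh (ν : ℝ) (z : ℂ) (hz : 0 < z.re) :
    Integrable fun s : ℝ => Complex.exp (-z * (Real.cosh s : ℝ)) *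
      ((Real.sinh s * Real.sinh (ν * s) : ℝ) : ℂ) :=
  integrable_weight z hz (fun s => Real.sinh s * Real.sinh (ν * s))
    (Real.continuous_sinh.mul (Real.continuous_sinh.comp (by fun_prop))) (1 + |ν|) (fun s => by
      rw [abs_mul, add_mul, Real.exp_add, one_mul]
      exact mul_le_mul (abs_sinh_le_exp_abs s) (abs_sinh_mul_le ν s) (abs_nonneg _)
        (Real.exp_pos _).le)

lemma besselK_eq (ν : ℝ) (z : ℂ) (hz : 0 < z.re) :
    2 * besselK ν z =
      ∫ s : ℝ, Complex.exp (-z * (Real.cosh s : ℝ)) * (Real.cosh (ν * s) : ℂ) := by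
  rw [integral_even (int_cosh ν z hz) (fun s => by simp [Real.cosh_neg])]
  rfl

lemma besselK_eq_exp (ν : ℝ) (z : ℂ) (hz : 0 < z.re) :
    2 * besselK ν z =
      ∫ s : ℝ, Complex.exp (-z * (Real.cosh s : ℝ)) * (Real.exp (ν * s) : ℂ) := by
  rw [besselK_eq ν z hz]
  have h1 : ∀ s : ℝ, Complex.exp (-z * (Real.cosh s : ℝ)) * (Real.cosh (ν * s) : ℂ) =
      Complex.exp (-z * (Real.cosh s : ℝ)) * (Real.exp (ν * s) : ℂ) -
      Complex.exp (-z * (Real.cosh s : ℝ)) * (Real.sinh (ν * s) : ℂ) := by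
    intro s
    rw [← Real.cosh_add_sinh (ν * s)]; push_cast; ring
  simp_rw [h1]
  rw [integral_sub (int_exp ν z hz) (int_sinh ν z hz)]
  have h2 : ∫ s : ℝ, Complex.exp (-z * (Real.cosh s : ℝ)) * (Real.sinh (ν * s) : ℂ) = 0 := by
    have := integral_neg_eq_self
      (fun s : ℝ => Complex.exp (-z * (Real.cosh s : ℝ)) * (Real.sinh (ν * s) : ℂ)) volume
    simp only [Real.cosh_neg, mul_neg, Real.sinh_neg, Complex.ofReal_neg, integral_neg] at this
    exact self_eq_neg.1 this.symm
  rw [h2, sub_zero]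

/-- recurrence -/
lemma recurrence (ν : ℝ) (z : ℂ) (hz : 0 < z.re) :
    besselK' ν z = -besselK (ν - 1) z - ν / z * besselK ν z := by
  have hz0 : z ≠ 0 := by rintro rfl; simp at hz
  have hpt : ∀ s : ℝ, Complex.exp (-z * (Real.cosh s : ℝ)) * (Real.cosh s : ℂ) *
      (Real.cosh (ν * s) : ℂ) =
      Complex.exp (-z * (Real.cosh s : ℝ)) * (Real.cosh ((ν - 1) * s) : ℂ) +
      Complex.exp (-z * (Real.cosh s : ℝ)) * ((Real.sinh s * Real.sinh (ν * s) : ℝ) : ℂ) := by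
    intro s
    rw [sub_mul, one_mul, Real.cosh_sub]; push_cast; ring
  have hint := (int_cosh (ν - 1) z hz).add (int_sinh_sinh ν z hz)
  have hK' : 2 * besselK' ν z = -∫ s : ℝ, Complex.exp (-z * (Real.cosh s : ℝ)) *
      (Real.cosh s : ℂ) * (Real.cosh (ν * s) : ℂ) := by
    rw [integral_even (hint.congr (Filter.Eventually.of_forall fun s => (hpt s).symm))
      (fun s => by simp [Real.cosh_neg]), besselK']
    ring
  simp_rw [hpt] at hK'
  rw [integral_add (int_cosh (ν - 1) z hz) (int_sinh_sinh ν z hz),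
    ← besselK_eq (ν - 1) z hz] at hK'
  have hd : ∀ s : ℝ, HasDerivAt
      (fun s : ℝ => Complex.exp (-z * (Real.cosh s : ℝ)) * (Real.sinh (ν * s) : ℂ))
      (ν * (Complex.exp (-z * (Real.cosh s : ℝ)) * (Real.cosh (ν * s) : ℂ)) -
      z * (Complex.exp (-z * (Real.cosh s : ℝ)) * ((Real.sinh s * Real.sinh (ν * s) : ℝ) : ℂ)))
      s := by
    intro s
    have a1 : HasDerivAt (fun s : ℝ => Complex.exp (-z * (Real.cosh s : ℝ))) _ s :=
      (((Real.hasDerivAt_cosh s).ofReal_comp).const_mul (-z)).cexp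
    have a2 : HasDerivAt (fun s : ℝ => (Real.sinh (ν * s) : ℂ)) _ s :=
      (((hasDerivAt_id s).const_mul ν).sinh).ofReal_comp
    refine (a1.mul a2).congr_deriv ?_
    push_cast; simp only [id, mul_one]; ring
  have h0 := integral_eq_zero_of_hasDerivAt_of_integrable hd
    (((int_cosh ν z hz).const_mul _).sub ((int_sinh_sinh ν z hz).const_mul _)) (int_sinh ν z hz)
  rw [integral_sub ((int_cosh ν z hz).const_mul _) ((int_sinh_sinh ν z hz).const_mul _),
    integral_const_mul, integral_const_mul, ← besselK_eq ν z hz] at h0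
  have h3 : ∫ s : ℝ, Complex.exp (-z * (Real.cosh s : ℝ)) *
      ((Real.sinh s * Real.sinh (ν * s) : ℝ) : ℂ) = ν / z * (2 * besselK ν z) := by
    rw [div_mul_eq_mul_div, eq_div_iff hz0]
    linear_combination -h0
  rw [h3] at hK'
  linear_combination hK' / 2

/-- rotated integrand -/
noncomputable def rot (R θ b : ℝ) : ℂ := Complex.exp (-R * Complex.cosh (b + θ * Complex.I))

lemma cosh_rot (θ b : ℝ) : Complex.cosh (b + θ * Complex.I) =
    (Real.cosh b * Real.cos θ : ℝ) + (Real.sinh b * Real.sin θ : ℝ) * Complex.I := by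
  rw [Complex.cosh_add, Complex.cosh_mul_I, Complex.sinh_mul_I]; push_cast; ring

lemma norm_rot (R θ b : ℝ) : ‖rot R θ b‖ = Real.exp (-(R * Real.cos θ) * Real.cosh b) := by
  rw [rot, Complex.norm_exp, cosh_rot]
  congr 1
  simp [-Complex.ofReal_cos, -Complex.ofReal_sin, -Complex.ofReal_cosh, -Complex.ofReal_sinh]
  ring

lemma norm_sinh_rot (θ b : ℝ) : ‖Complex.sinh (b + θ * Complex.I)‖ ≤ Real.exp |b| := by
  refine le_trans ?_ (cosh_le_exp_abs b)
  rw [Complex.sinh]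
  have h1 : ‖Complex.exp (b + θ * Complex.I)‖ = Real.exp b := by rw [Complex.norm_exp]; simp
  have h2 : ‖Complex.exp (-(b + θ * Complex.I))‖ = Real.exp (-b) := by rw [Complex.norm_exp]; simp
  rw [norm_div, Real.cosh_eq, ← h1, ← h2]
  simp only [Complex.norm_ofNat]
  gcongr
  exact norm_sub_le _ _

lemma rot_const (R : ℝ) (hR : 0 < R) (θ : ℝ) (hθ : |θ| < Real.pi / 2) :
    ∫ b, rot R θ b = ∫ b, rot R 0 b := by
  set S := Set.Ioo (-(Real.pi / 2)) (Real.pi / 2)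
  have hcont : ∀ θ, Continuous (rot R θ) := fun θ => by
    unfold rot
    have := Complex.continuous_cosh
    fun_prop
  have hcont' : ∀ θ : ℝ, Continuous fun b : ℝ =>
      rot R θ b * (-R * Complex.sinh (b + θ * Complex.I)) := fun θ => by
    have := Complex.continuous_sinh
    have := hcont θ
    fun_prop
  have hb : ∀ θ b : ℝ, ‖rot R θ b * (-R * Complex.sinh (b + θ * Complex.I))‖ ≤
      R * (Real.exp (-(R * Real.cos θ) * Real.cosh b) * Real.exp (1 * |b|)) := fun θ b => by
    rw [norm_mul, norm_rot, norm_mul, norm_neg, Complex.norm_real, Real.norm_of_nonneg hR.le,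
      one_mul]
    have := mul_le_mul_of_nonneg_left (norm_sinh_rot θ b)
      (mul_nonneg hR.le (Real.exp_pos (-(R * Real.cos θ) * Real.cosh b)).le)
    linarith
  have hint : ∀ θ ∈ S, Integrable (rot R θ) := fun θ h =>
    integrable_of_bound (hcont θ) 1 (R * Real.cos θ) 0
      (mul_pos hR (Real.cos_pos_of_mem_Ioo h)) (fun b => by simp [norm_rot])
  have hint' : ∀ θ ∈ S, Integrable fun b : ℝ =>
      rot R θ b * (-R * Complex.sinh (b + θ * Complex.I)) := fun θ h =>
    integrable_of_bound (hcont' θ) R (R * Real.cos θ) 1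
      (mul_pos hR (Real.cos_pos_of_mem_Ioo h)) (hb θ)
  have hder : ∀ θ ∈ S, HasDerivAt (fun θ => ∫ b, rot R θ b) 0 θ := by
    intro θ hθ
    have hzero : ∫ b : ℝ, rot R θ b * (-R * Complex.sinh (b + θ * Complex.I)) = 0 := by
      refine integral_eq_zero_of_hasDerivAt_of_integrable (f := rot R θ) ?_ (hint' θ hθ) (hint θ hθ)
      intro b
      have a1 : HasDerivAt (fun b : ℝ => (b : ℂ) + θ * Complex.I) 1 b :=
        (Complex.ofRealCLM.hasDerivAt).add_const _
      have := (((Complex.hasDerivAt_cosh _).comp b a1).const_mul (-R : ℂ)).cexp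
      refine this.congr_deriv ?_
      simp only [rot, Function.comp_apply]; ring
    obtain ⟨θ₁, h1, h2⟩ := exists_between (abs_lt.2 hθ)
    have hcos : 0 < Real.cos θ₁ :=
      Real.cos_pos_of_mem_Ioo ⟨by have := abs_nonneg θ; linarith, h2⟩
    have key := hasDerivAt_integral_of_dominated_loc_of_deriv_le (μ := volume)
      (F := rot R) (x₀ := θ) (s := Set.Ioo (-θ₁) θ₁)
      (F' := fun θ b => rot R θ b * (-R * Complex.sinh (b + θ * Complex.I)) * Complex.I)
      (bound := fun b => R * (Real.exp (-(R * Real.cos θ₁) * Real.cosh b) * Real.exp (1 * |b|)))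
      (Ioo_mem_nhds (abs_lt.1 h1).1 (abs_lt.1 h1).2)
      (Filter.Eventually.of_forall fun θ => (hcont θ).aestronglyMeasurable)
      (hint θ hθ) ((hcont' θ).mul continuous_const).aestronglyMeasurable
      (Filter.Eventually.of_forall fun b x hx => by
        rw [norm_mul, Complex.norm_I, mul_one]
        refine (hb x b).trans ?_
        have hc : Real.cos θ₁ ≤ Real.cos x := by
          rw [← Real.cos_abs x]
          exact Real.cos_le_cos_of_nonneg_of_le_pi (abs_nonneg x) (by linarith [Real.pi_pos])
            (abs_lt.2 hx).le
        have := Real.cosh_pos b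
        gcongr)
      ((integrable_bound _ 1 (mul_pos hR hcos)).const_mul R)
      (Filter.Eventually.of_forall fun b x _ => by
        have a1 : HasDerivAt (fun x : ℝ => (b : ℂ) + x * Complex.I) Complex.I x := by
          simpa using ((Complex.ofRealCLM.hasDerivAt (x := x)).mul_const Complex.I).const_add (b : ℂ)
        have := (((Complex.hasDerivAt_cosh _).comp x a1).const_mul (-R : ℂ)).cexp
        refine this.congr_deriv ?_
        simp only [rot, Function.comp_apply]; ring)
    have := key.2
    rwa [integral_mul_const, hzero, zero_mul] at this
  refine isOpen_Ioo.is_const_of_deriv_eq_zero (s := S) isPreconnected_Ioo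
    (f := fun θ => ∫ b, rot R θ b)
    (fun x hx => (hder x hx).differentiableAt.differentiableWithinAt)
    (fun x hx => (hder x hx).deriv) (abs_lt.1 hθ) ?_
  exact ⟨by have := Real.pi_pos; linarith, by have := Real.pi_pos; linarith⟩

lemma rot_pos (R θ : ℝ) (hR : 0 < R) (hθ : |θ| < Real.pi / 2) :
    ∃ r : ℝ, 0 ≤ r ∧ ∫ b, rot R θ b = r := by
  refine ⟨∫ b, Real.exp (-R * Real.cosh b), integral_nonneg fun b => (Real.exp_pos _).le, ?_⟩
  rw [rot_const R hR θ hθ, ← integral_complex_ofReal]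
  congr 1
  ext b
  simp [rot]

lemma AB_pos (A B : ℝ) (hA : 0 < A) :
    ∃ r : ℝ, 0 ≤ r ∧
      ∫ b : ℝ, Complex.exp (-((A * Real.cosh b : ℝ) + (B * Real.sinh b : ℝ) * Complex.I)) = r := by
  set w : ℂ := ⟨A, B⟩ with hw
  have hw0 : w ≠ 0 := fun h => hA.ne' (by simpa [hw] using congrArg Complex.re h)
  obtain ⟨r, hr, h⟩ := rot_pos ‖w‖ w.arg (norm_pos_iff.2 hw0)
    (Complex.abs_arg_lt_pi_div_two_iff.2 (Or.inl hA))
  refine ⟨r, hr, ?_⟩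
  rw [← h]
  congr 1
  ext b
  rw [rot, cosh_rot]
  have h1 : A = ‖w‖ * Real.cos w.arg := by rw [Complex.norm_mul_cos_arg]
  have h2 : B = ‖w‖ * Real.sin w.arg := by rw [Complex.norm_mul_sin_arg]
  congr 1
  rw [show A * Real.cosh b = ‖w‖ * (Real.cosh b * Real.cos w.arg) by
      linear_combination Real.cosh b * h1,
    show B * Real.sinh b = ‖w‖ * (Real.sinh b * Real.sin w.arg) by
      linear_combination Real.sinh b * h2]
  push_cast; ring

open ComplexConjugate

/-- the kernel -/
noncomputable def G (z : ℂ) (c : ℝ) : ℂ :=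
  ∫ t : ℝ, Complex.exp (-z * (Real.cosh t : ℝ)) *
    Complex.exp (-(conj z) * (Real.cosh (c - t) : ℝ))

lemma G_eq (z : ℂ) (c : ℝ) : G z c = ∫ b : ℝ, Complex.exp
    (-((2 * z.re * Real.cosh (c / 2) * Real.cosh b : ℝ) +
      (2 * z.im * Real.sinh (c / 2) * Real.sinh b : ℝ) * Complex.I)) := by
  rw [G, ← integral_add_right_eq_self _ (c / 2)]
  congr 1
  ext b
  rw [← Complex.exp_add, show c - (b + c / 2) = c / 2 - b by ring, add_comm b,
    Real.cosh_add, Real.cosh_sub]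
  congr 1
  apply Complex.ext <;> simp [-Complex.ofReal_cosh, -Complex.ofReal_sinh] <;> ring

lemma G_pos (z : ℂ) (hz : 0 < z.re) (c : ℝ) : ∃ r : ℝ, 0 ≤ r ∧ G z c = r := by
  rw [G_eq]
  exact AB_pos _ _ (by have := Real.cosh_pos (c / 2); positivity)

lemma G_even (z : ℂ) (c : ℝ) : G z (-c) = G z c := by
  rw [G_eq, G_eq, ← integral_neg_eq_self]
  congr 1
  ext b
  rw [neg_div]
  simp only [Real.cosh_neg, Real.sinh_neg, mul_neg, neg_mul, neg_neg]

lemma conj_besselK (ν : ℝ) (z : ℂ) : besselK ν (conj z) = conj (besselK ν z) := by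
  rw [besselK, besselK, ← integral_conj]
  congr 1
  ext t
  rw [map_mul, ← Complex.exp_conj, map_mul, map_neg, Complex.conj_ofReal, Complex.conj_ofReal]

lemma conv (ν : ℝ) (z : ℂ) (hz : 0 < z.re) :
    Integrable (fun c : ℝ => (Real.exp (ν * c) : ℂ) * G z c) ∧
    ∫ c : ℝ, (Real.exp (ν * c) : ℂ) * G z c = ((4 * ‖besselK ν z‖ ^ 2 : ℝ) : ℂ) := by
  have hz' : 0 < (conj z).re := by simpa using hz
  have h1 := int_exp ν z hz
  have h2 := int_exp ν (conj z) hz'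
  have hi := h1.integrable_convolution (ContinuousLinearMap.mul ℂ ℂ) h2
  have hv := integral_convolution (ContinuousLinearMap.mul ℂ ℂ) h1 h2
  have he : convolution (fun s : ℝ => Complex.exp (-z * (Real.cosh s : ℝ)) * (Real.exp (ν * s) : ℂ))
      (fun s : ℝ => Complex.exp (-(conj z) * (Real.cosh s : ℝ)) * (Real.exp (ν * s) : ℂ))
      (ContinuousLinearMap.mul ℂ ℂ) volume = fun c : ℝ => (Real.exp (ν * c) : ℂ) * G z c := by
    ext c
    rw [convolution_def, G, ← integral_const_mul]
    congr 1
    ext t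
    rw [ContinuousLinearMap.mul_apply', show ν * c = ν * t + ν * (c - t) by ring, Real.exp_add]
    push_cast
    ring
  rw [he] at hi hv
  refine ⟨hi, ?_⟩
  rw [hv, ContinuousLinearMap.mul_apply', ← besselK_eq_exp ν z hz, ← besselK_eq_exp ν _ hz',
    conj_besselK]
  have := Complex.mul_conj' (besselK ν z)
  push_cast
  linear_combination 4 * this

lemma norm_mono (μ ν : ℝ) (h0 : 0 ≤ μ) (h : μ ≤ ν) (z : ℂ) (hz : 0 < z.re) :
    ‖besselK μ z‖ ≤ ‖besselK ν z‖ := by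
  choose r hr hG using G_pos z hz
  have hre : ∀ c, r (-c) = r c := fun c => by
    have := G_even z c
    rw [hG, hG] at this
    exact_mod_cast this
  have key : ∀ ν : ℝ, Integrable (fun c : ℝ => Real.cosh (ν * c) * r c) ∧
      ∫ c : ℝ, Real.cosh (ν * c) * r c = 4 * ‖besselK ν z‖ ^ 2 := by
    intro ν
    obtain ⟨hi, hv⟩ := conv ν z hz
    have hfun : (fun c : ℝ => (Real.exp (ν * c) : ℂ) * G z c) =
        fun c : ℝ => ((Real.exp (ν * c) * r c : ℝ) : ℂ) := by
      ext c; rw [hG]; push_cast; rfl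
    rw [hfun] at hi hv
    have hi' : Integrable (fun c : ℝ => Real.exp (ν * c) * r c) := by
      exact hi.re
    rw [integral_complex_ofReal] at hv
    have hv' : ∫ c : ℝ, Real.exp (ν * c) * r c = 4 * ‖besselK ν z‖ ^ 2 := by exact_mod_cast hv
    have hn : Integrable (fun c : ℝ => Real.exp (-(ν * c)) * r c) := by
      simpa [hre] using hi'.comp_neg
    have hnv : ∫ c : ℝ, Real.exp (-(ν * c)) * r c = 4 * ‖besselK ν z‖ ^ 2 := by
      rw [← hv', ← integral_neg_eq_self]
      simp [hre]
    have hs : (fun c : ℝ => Real.cosh (ν * c) * r c) = fun c : ℝ =>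
        (Real.exp (ν * c) * r c + Real.exp (-(ν * c)) * r c) / 2 := by
      ext c; rw [Real.cosh_eq]; ring
    rw [hs]
    refine ⟨(hi'.add hn).div_const 2, ?_⟩
    rw [integral_div, integral_add hi' hn, hv', hnv]
    ring
  have hle : 4 * ‖besselK μ z‖ ^ 2 ≤ 4 * ‖besselK ν z‖ ^ 2 := by
    rw [← (key μ).2, ← (key ν).2]
    refine integral_mono (key μ).1 (key ν).1 fun c => ?_
    refine mul_le_mul_of_nonneg_right (Real.cosh_le_cosh.2 ?_) (hr c)
    rw [abs_mul, abs_mul, abs_of_nonneg h0, abs_of_nonneg (h0.trans h)]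
    exact mul_le_mul_of_nonneg_right h (abs_nonneg c)
  exact le_of_sq_le_sq (by linarith) (norm_nonneg _)

end BesselAux

/-- For an integer `n ≥ 1` and `z ∈ ℂ` with `Re z > 0`,
`|K_n'(z)| ≤ (n/|z| + 1) |K_n(z)|`. -/
theorem abs_besselK'_le (n : ℕ) (hn : 1 ≤ n) (z : ℂ) (hz : 0 < z.re) :
    ‖besselK' (n : ℝ) z‖ ≤ ((n : ℝ) / ‖z‖ + 1) * ‖besselK (n : ℝ) z‖ := by
  have hn' : (1 : ℝ) ≤ n := by exact_mod_cast hn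
  have hm := BesselAux.norm_mono ((n : ℝ) - 1) n (by linarith) (by linarith) z hz
  rw [BesselAux.recurrence _ z hz]
  refine (norm_sub_le _ _).trans ?_
  rw [norm_neg, norm_mul, norm_div, Complex.norm_real, Real.norm_of_nonneg (by linarith)]
  linarith
end

section
/- Let s ∈ ℂ with Re s > 0 and let R > 0. Let (ω_n)_{n≥1} and (φ_n)_{n≥1} be sequences of complex numbers with Σ_{n≥1} √(1+n²)|ω_n|² < ∞ and Σ_{n≥1} √(1+n²)|φ_n|² < ∞. Then the series Σ_{n≥1} (K_n'(sR)/K_n(sR)) ω_n · conj(φ_n) converges absolutely and |sR · Σ_{n=1}^∞ (K_n'(sR)/K_n(sR)) ω_n conj(φ_n)| ≤ (1 + |s|R) · (Σ_{n≥1} √(1+n²)|ω_n|²)^{1/2} · (Σ_{n≥1} √(1+n²)|φ_n|²)^{1/2}. -/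
open MeasureTheory

lemma cosh_ge_quad (t : ℝ) : t ^ 2 / 4 ≤ Real.cosh t := by
  rw [← Real.cosh_abs, Real.cosh_eq]
  have h := Real.quadratic_le_exp_of_nonneg (abs_nonneg t)
  have h2 := Real.exp_pos (-|t|)
  rw [sq_abs] at h
  have := abs_nonneg t
  linarith

lemma integrable_exp_cosh (c m : ℝ) (hc : 0 < c) :
    Integrable (fun t : ℝ => Real.exp (-(c * Real.cosh t) + m * t)) := by
  have h := (integrable_cexp_quadratic' (b := ((-(c / 4) : ℝ) : ℂ))
    (by rw [Complex.ofReal_re]; linarith) (m : ℂ) 0).norm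
  refine h.mono' (by fun_prop) (Filter.Eventually.of_forall fun t => ?_)
  rw [Real.norm_eq_abs, Real.abs_exp, Complex.norm_exp]
  apply Real.exp_le_exp.2
  have := cosh_ge_quad t
  have e : (((-(c / 4) : ℝ) : ℂ) * (t : ℂ) ^ 2 + (m : ℂ) * t + 0).re = -(c / 4) * t ^ 2 + m * t := by
    norm_cast
    rw [add_zero]
  rw [e]
  nlinarith

/-- integrand on the contour -/
noncomputable def EE (p q b : ℝ) : ℂ :=
  Complex.exp (((-(p * Real.cosh b) : ℝ) : ℂ) + ((-(q * Real.sinh b) : ℝ) : ℂ) * Complex.I)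

lemma norm_EE (p q b : ℝ) : ‖EE p q b‖ = Real.exp (-(p * Real.cosh b)) := by
  rw [EE, Complex.norm_exp]; simp

lemma EE_cont (p q : ℝ) : Continuous (EE p q) := by
  unfold EE; fun_prop

lemma EE_integrable (p q : ℝ) (hp : 0 < p) : Integrable (EE p q) := by
  have h := integrable_exp_cosh p 0 hp
  refine h.mono' (EE_cont p q).aestronglyMeasurable (Filter.Eventually.of_forall fun t => ?_)
  rw [norm_EE]; simp

lemma integrable_cosh_exp (p : ℝ) (hp : 0 < p) :
    Integrable (fun b : ℝ => Real.cosh b * Real.exp (-(p * Real.cosh b))) := by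
  have h := ((integrable_exp_cosh p 1 hp).add (integrable_exp_cosh p (-1) hp)).div_const 2
  refine h.congr (Filter.Eventually.of_forall fun t => ?_)
  simp only [Pi.add_apply, Real.exp_add, Real.cosh_eq t, one_mul, neg_mul]
  ring

lemma abs_sinh_le_cosh (b : ℝ) : |Real.sinh b| ≤ Real.cosh b := by
  rw [abs_le, Real.sinh_eq, Real.cosh_eq]
  have := Real.exp_pos b
  have := Real.exp_pos (-b)
  constructor <;> linarith

noncomputable def EEd (p q b : ℝ) : ℂ :=
  EE p q b * (((-(p * Real.sinh b) : ℝ) : ℂ) + ((-(q * Real.cosh b) : ℝ) : ℂ) * Complex.I)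

lemma EE_hasDeriv (p q b : ℝ) : HasDerivAt (EE p q) (EEd p q b) b := by
  unfold EE EEd
  have h1 := (((Real.hasDerivAt_cosh b).const_mul p).neg).ofReal_comp
  have h2 := ((((Real.hasDerivAt_sinh b).const_mul q).neg).ofReal_comp).mul_const Complex.I
  exact (h1.add h2).cexp

lemma norm_EEd (p q b : ℝ) :
    ‖EEd p q b‖ ≤ (|p| + |q|) * (Real.cosh b * Real.exp (-(p * Real.cosh b))) := by
  rw [EEd, norm_mul, norm_EE]
  have : ‖(((-(p * Real.sinh b) : ℝ) : ℂ) + ((-(q * Real.cosh b) : ℝ) : ℂ) * Complex.I)‖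
      ≤ |p| * Real.cosh b + |q| * Real.cosh b := by
    refine (norm_add_le _ _).trans ?_
    rw [norm_mul, Complex.norm_I, Complex.norm_real, Complex.norm_real, norm_neg, norm_neg,
      norm_mul, norm_mul, Real.norm_eq_abs, Real.norm_eq_abs, Real.norm_eq_abs, Real.norm_eq_abs,
      abs_of_pos (Real.cosh_pos b), mul_one]
    have := abs_sinh_le_cosh b
    gcongr
  calc _ ≤ Real.exp (-(p * Real.cosh b)) * (|p| * Real.cosh b + |q| * Real.cosh b) := by gcongr
    _ = _ := by ring

lemma EEd_cont (p q : ℝ) : Continuous (EEd p q) := by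
  unfold EEd EE; fun_prop

lemma EEd_integral (p q : ℝ) (hp : 0 < p) : ∫ b, EEd p q b = 0 := by
  refine integral_eq_zero_of_hasDerivAt_of_integrable (EE_hasDeriv p q) ?_ (EE_integrable p q hp)
  exact ((integrable_cosh_exp p hp).const_mul (|p| + |q|)).mono'
    (EEd_cont p q).aestronglyMeasurable (Filter.Eventually.of_forall fun b => norm_EEd p q b)

lemma contour_hasDeriv (ρ θ : ℝ) (hρ : 0 < ρ) (hθ : 0 < Real.cos θ) :
    HasDerivAt (fun x => ∫ b, EE (ρ * Real.cos x) (ρ * Real.sin x) b) 0 θ := by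
  set c := Real.cos θ / 2 with hc
  have hc0 : 0 < c := by positivity
  have key := hasDerivAt_integral_of_dominated_loc_of_deriv_le (μ := (volume : Measure ℝ))
    (s := {x : ℝ | c < Real.cos x}) (x₀ := θ)
    (F := fun x b => EE (ρ * Real.cos x) (ρ * Real.sin x) b)
    (F' := fun x b => Complex.I * EEd (ρ * Real.cos x) (ρ * Real.sin x) b)
    (bound := fun b => (ρ + ρ) * (Real.cosh b * Real.exp (-((ρ * c) * Real.cosh b))))
    ((isOpen_lt continuous_const Real.continuous_cos).mem_nhds (by
      change c < Real.cos θ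
      linarith))
    (Filter.Eventually.of_forall fun x => (EE_cont _ _).aestronglyMeasurable)
    (EE_integrable _ _ (by positivity))
    ((continuous_const.mul (EEd_cont _ _)).aestronglyMeasurable)
    (Filter.Eventually.of_forall fun b x hx => ?_)
    ((integrable_cosh_exp _ (by positivity)).const_mul _)
    (Filter.Eventually.of_forall fun b x hx => ?_)
  · have := key.2
    rwa [integral_const_mul, EEd_integral _ _ (by positivity), mul_zero] at this
  · rw [norm_mul, Complex.norm_I, one_mul]
    refine (norm_EEd _ _ _).trans ?_
    have hx : c < Real.cos x := hx
    have := Real.cosh_pos b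
    have h1 : |ρ * Real.cos x| ≤ ρ := by
      rw [abs_mul, abs_of_pos hρ]
      exact mul_le_of_le_one_right hρ.le (Real.abs_cos_le_one x)
    have h2 : |ρ * Real.sin x| ≤ ρ := by
      rw [abs_mul, abs_of_pos hρ]
      exact mul_le_of_le_one_right hρ.le (Real.abs_sin_le_one x)
    gcongr
  · have h1 := ((((Real.hasDerivAt_cos x).const_mul ρ).mul_const (Real.cosh b)).neg).ofReal_comp
    have h2 := (((((Real.hasDerivAt_sin x).const_mul ρ).mul_const
      (Real.sinh b)).neg).ofReal_comp).mul_const Complex.I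
    have h3 := (h1.add h2).cexp
    unfold EEd EE
    refine h3.congr_deriv ?_
    simp only [Pi.add_apply, Pi.neg_apply]
    set X := Complex.exp (((-(ρ * Real.cos x * Real.cosh b) : ℝ) : ℂ) +
      ((-(ρ * Real.sin x * Real.sinh b) : ℝ) : ℂ) * Complex.I)
    push_cast
    linear_combination (X * ρ * Complex.sin x * Complex.cosh b) * Complex.I_sq

lemma contour_nonneg (p q : ℝ) (hp : 0 < p) : ∃ r : ℝ, 0 ≤ r ∧ ∫ b, EE p q b = r := by
  let z : ℂ := ⟨p, q⟩
  have hz : z ≠ 0 := fun h => by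
    have : z.re = 0 := by rw [h]; rfl
    exact hp.ne' this
  have hρ : 0 < ‖z‖ := norm_pos_iff.2 hz
  have hre : ‖z‖ * Real.cos z.arg = p := Complex.norm_mul_cos_arg z
  have him : ‖z‖ * Real.sin z.arg = q := Complex.norm_mul_sin_arg z
  have harg : z.arg ∈ Set.Ioo (-(Real.pi / 2)) (Real.pi / 2) :=
    abs_lt.1 (Complex.abs_arg_lt_pi_div_two_iff.2 (Or.inl hp))
  have h0 : (0 : ℝ) ∈ Set.Ioo (-(Real.pi / 2)) (Real.pi / 2) := by
    constructor <;> linarith [Real.pi_pos]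
  have hd : ∀ x ∈ Set.Ioo (-(Real.pi / 2)) (Real.pi / 2),
      HasDerivAt (fun x => ∫ b, EE (‖z‖ * Real.cos x) (‖z‖ * Real.sin x) b) 0 x :=
    fun x hx => contour_hasDeriv _ _ hρ (Real.cos_pos_of_mem_Ioo hx)
  have := isOpen_Ioo.is_const_of_deriv_eq_zero isPreconnected_Ioo
    (fun x hx => (hd x hx).differentiableAt.differentiableWithinAt)
    (fun x hx => (hd x hx).deriv) harg h0
  simp only [hre, him] at this
  rw [this]
  refine ⟨∫ b, Real.exp (-(‖z‖ * Real.cosh b)), integral_nonneg fun b => (Real.exp_pos _).le, ?_⟩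
  rw [← integral_complex_ofReal]
  congr 1
  ext b
  simp [EE]

noncomputable def GG (z : ℂ) (ν t : ℝ) : ℂ :=
  Complex.exp (-z * (Real.cosh t : ℂ) + ((ν * t : ℝ) : ℂ))

noncomputable def AA (z : ℂ) (ν : ℝ) : ℂ := ∫ t, GG z ν t

lemma GG_cont (z : ℂ) (ν : ℝ) : Continuous (GG z ν) := by
  unfold GG; fun_prop

lemma GG_integrable (z : ℂ) (hz : 0 < z.re) (ν : ℝ) : Integrable (GG z ν) := by
  refine (integrable_exp_cosh z.re ν hz).mono' (GG_cont z ν).aestronglyMeasurable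
    (Filter.Eventually.of_forall fun t => ?_)
  rw [GG, Complex.norm_exp, Complex.add_re, Complex.ofReal_re, Complex.re_mul_ofReal,
    Complex.neg_re, neg_mul]

lemma AA_neg (z : ℂ) (ν : ℝ) : AA z (-ν) = AA z ν := by
  unfold AA
  rw [← integral_neg_eq_self]
  congr 1
  ext t
  simp [GG]

lemma GG_mul (z : ℂ) (ν v b : ℝ) :
    GG z ν (b + v / 2) * (starRingEnd ℂ) (GG z ν (v - (b + v / 2))) =
      ((Real.exp (ν * v) : ℝ) : ℂ) *
        EE (2 * z.re * Real.cosh (v / 2)) (2 * z.im * Real.sinh (v / 2)) b := by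
  have e : v - (b + v / 2) = v / 2 - b := by ring
  unfold GG EE
  rw [e, ← Complex.exp_conj, ← Complex.exp_add, Complex.ofReal_exp, ← Complex.exp_add]
  congr 1
  apply Complex.ext
  · simp only [Complex.add_re, Complex.conj_re, Complex.ofReal_re,
      Complex.neg_re, Complex.I_re, Complex.I_im, Complex.mul_re, Complex.ofReal_im]
    rw [add_comm b, Real.cosh_add, Real.cosh_sub]
    ring
  · simp only [Complex.add_im, Complex.conj_im, Complex.ofReal_im,
      Complex.neg_im, Complex.I_re, Complex.I_im, Complex.mul_im, Complex.ofReal_re]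
    rw [add_comm b, Real.cosh_add, Real.cosh_sub]
    ring

lemma AA_sq (z : ℂ) (hz : 0 < z.re) : ∃ r : ℝ → ℝ, (∀ v, 0 ≤ r v) ∧ ∀ ν : ℝ,
    Integrable (fun v => Real.exp (ν * v) * r v) ∧
      ∫ v, Real.exp (ν * v) * r v = ‖AA z ν‖ ^ 2 := by
  have H : ∀ v : ℝ, ∃ r : ℝ, 0 ≤ r ∧
      ∫ b, EE (2 * z.re * Real.cosh (v / 2)) (2 * z.im * Real.sinh (v / 2)) b = r := fun v =>
    contour_nonneg _ _ (by have := Real.cosh_pos (v / 2); positivity)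
  choose r hr hr2 using H
  refine ⟨r, hr, fun ν => ?_⟩
  have hf := GG_integrable z hz ν
  have hg : Integrable (fun t => (starRingEnd ℂ) (GG z ν t)) :=
    (hf.norm).mono' ((Complex.continuous_conj.comp (GG_cont z ν)).aestronglyMeasurable)
      (Filter.Eventually.of_forall fun t => by simp)
  have e : convolution (GG z ν) (fun t => (starRingEnd ℂ) (GG z ν t))
      (ContinuousLinearMap.mul ℝ ℂ) volume = fun v => ((Real.exp (ν * v) * r v : ℝ) : ℂ) := by
    ext v
    rw [convolution_def, ← integral_add_right_eq_self _ (v / 2)]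
    simp only [ContinuousLinearMap.mul_apply', GG_mul]
    rw [integral_const_mul, hr2, Complex.ofReal_mul]
  have i1 := hf.integrable_convolution (ContinuousLinearMap.mul ℝ ℂ) hg
  have i2 := integral_convolution (ContinuousLinearMap.mul ℝ ℂ) hf hg
  rw [e] at i1 i2
  refine ⟨i1.re, ?_⟩
  rw [integral_complex_ofReal, ContinuousLinearMap.mul_apply', integral_conj] at i2
  change _ = AA z ν * (starRingEnd ℂ) (AA z ν) at i2
  rw [Complex.mul_conj'] at i2
  exact_mod_cast i2

lemma AA_mono (z : ℂ) (hz : 0 < z.re) (μ ν : ℝ) (h : |μ| ≤ |ν|) : ‖AA z μ‖ ≤ ‖AA z ν‖ := by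
  obtain ⟨r, hr, H⟩ := AA_sq z hz
  have K : ∀ ν : ℝ, Integrable (fun v => Real.cosh (ν * v) * r v) ∧
      ∫ v, Real.cosh (ν * v) * r v = ‖AA z ν‖ ^ 2 := by
    intro ν
    obtain ⟨a1, a2⟩ := H ν
    obtain ⟨b1, b2⟩ := H (-ν)
    have e : (fun v => Real.cosh (ν * v) * r v) =
        fun v => (Real.exp (ν * v) * r v + Real.exp (-ν * v) * r v) / 2 := by
      ext v
      rw [Real.cosh_eq, neg_mul]
      ring
    rw [e]
    refine ⟨(a1.add b1).div_const 2, ?_⟩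
    rw [integral_div, integral_add a1 b1, a2, b2, AA_neg]
    ring
  refine (sq_le_sq₀ (norm_nonneg _) (norm_nonneg _)).1 ?_
  rw [← (K μ).2, ← (K ν).2]
  refine integral_mono (K μ).1 (K ν).1 fun v => ?_
  refine mul_le_mul_of_nonneg_right (Real.cosh_le_cosh.2 ?_) (hr v)
  rw [abs_mul, abs_mul]
  gcongr

lemma integral_fold (f : ℝ → ℂ) (hf : Integrable f) :
    ∫ t, f t = ∫ t in Set.Ioi (0 : ℝ), (f t + f (-t)) := by
  rw [integral_add hf.integrableOn hf.comp_neg.integrableOn, integral_comp_neg_Ioi, neg_zero,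
    add_comm, intervalIntegral.integral_Iic_add_Ioi hf.integrableOn hf.integrableOn]

lemma besselK_eq_s4 (z : ℂ) (hz : 0 < z.re) (ν : ℝ) : AA z ν = 2 * besselK ν z := by
  rw [AA, integral_fold _ (GG_integrable z hz ν), besselK, ← integral_const_mul]
  congr 1
  ext t
  simp only [GG, Real.cosh_neg, Complex.exp_add, Complex.ofReal_cosh (ν * t), Complex.cosh]
  push_cast
  rw [mul_neg]
  ring

lemma besselK'_eq (z : ℂ) (hz : 0 < z.re) (ν : ℝ) :
    AA z (ν + 1) + AA z (ν - 1) = -4 * besselK' ν z := by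
  rw [AA, AA, ← integral_add (GG_integrable z hz _) (GG_integrable z hz _),
    integral_fold (fun a => GG z (ν + 1) a + GG z (ν - 1) a)
      ((GG_integrable z hz _).add (GG_integrable z hz _)), besselK', neg_mul_neg,
    ← integral_const_mul]
  congr 1
  ext t
  have e1 : ((((ν + 1) * t : ℝ)) : ℂ) = (ν : ℂ) * t + t := by push_cast; ring
  have e2 : ((((ν - 1) * t : ℝ)) : ℂ) = (ν : ℂ) * t + -t := by push_cast; ring
  have e3 : ((((ν + 1) * -t : ℝ)) : ℂ) = -((ν : ℂ) * t) + -t := by push_cast; ring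
  have e4 : ((((ν - 1) * -t : ℝ)) : ℂ) = -((ν : ℂ) * t) + t := by push_cast; ring
  simp only [GG, Real.cosh_neg, e1, e2, e3, e4, Complex.exp_add]
  set X := Complex.exp (-z * (Real.cosh t : ℂ))
  rw [Complex.ofReal_cosh, Complex.ofReal_cosh, Complex.cosh, Complex.cosh]
  push_cast
  ring

lemma AA_rec (z : ℂ) (hz : 0 < z.re) (ν : ℝ) :
    z * (AA z (ν + 1) - AA z (ν - 1)) = 2 * ν * AA z ν := by
  have i0 := GG_integrable z hz ν
  have ip := GG_integrable z hz (ν + 1)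
  have im := GG_integrable z hz (ν - 1)
  have ipm : Integrable (fun t => GG z (ν + 1) t - GG z (ν - 1) t) := ip.sub im
  have hd : ∀ t, HasDerivAt (GG z ν)
      (ν * GG z ν t - z / 2 * (GG z (ν + 1) t - GG z (ν - 1) t)) t := by
    intro t
    have h1 := ((Real.hasDerivAt_cosh t).ofReal_comp).const_mul (-z)
    have h2 := ((hasDerivAt_id t).const_mul ν).ofReal_comp
    refine (h1.add h2).cexp.congr_deriv ?_
    have e1 : ((((ν + 1) * t : ℝ)) : ℂ) = (ν : ℂ) * t + t := by push_cast; ring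
    have e2 : ((((ν - 1) * t : ℝ)) : ℂ) = (ν : ℂ) * t + -t := by push_cast; ring
    simp only [GG, e1, e2, Complex.exp_add, Pi.add_apply, id, Complex.ofReal_mul]
    set X := Complex.exp (-z * (Real.cosh t : ℂ))
    rw [Complex.ofReal_sinh, Complex.sinh]
    push_cast
    ring
  have := integral_eq_zero_of_hasDerivAt_of_integrable hd
    ((i0.const_mul _).sub (ipm.const_mul _)) i0
  rw [integral_sub (i0.const_mul _) (ipm.const_mul _), integral_const_mul,
    integral_const_mul, integral_sub ip im] at this
  change ν * AA z ν - z / 2 * (AA z (ν + 1) - AA z (ν - 1)) = 0 at this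
  linear_combination (-2) * this

lemma bessel_bound (z : ℂ) (hz : 0 < z.re) (ν : ℝ) (hν : 1 ≤ ν) :
    ‖z * (besselK' ν z / besselK ν z)‖ ≤ ν + ‖z‖ := by
  have h1 := besselK_eq_s4 z hz ν
  have h2 := besselK'_eq z hz ν
  have h3 := AA_rec z hz ν
  have h4 := AA_mono z hz (ν - 1) ν (by
    rw [abs_of_nonneg (by linarith), abs_of_nonneg (by linarith)]; linarith)
  by_cases h0 : besselK ν z = 0
  · rw [h0, div_zero, mul_zero, norm_zero]
    positivity
  rw [mul_div_assoc', norm_div, div_le_iff₀ (norm_pos_iff.2 h0)]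
  have e : z * besselK' ν z = -(ν * besselK ν z + z * (AA z (ν - 1) / 2)) := by
    linear_combination (-1 / 4 : ℂ) * h3 + z / 4 * h2 - ν / 2 * h1
  rw [e, norm_neg]
  refine (norm_add_le _ _).trans ?_
  rw [h1, norm_mul, Complex.norm_ofNat] at h4
  rw [norm_mul, norm_mul, norm_div, Complex.norm_ofNat, Complex.norm_real, Real.norm_eq_abs,
    abs_of_nonneg (by linarith), add_mul]
  have : ‖AA z (ν - 1)‖ / 2 ≤ ‖besselK ν z‖ := by linarith
  gcongr

/-- Boundedness of the s-domain DtN form: if `Σ √(1+n²)|ω_n|² < ∞` and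
`Σ √(1+n²)|φ_n|² < ∞` (sequences indexed by `n ≥ 1`, here `n+1` with `n : ℕ`), then the
series `Σ (K_n'(sR)/K_n(sR)) ω_n conj(φ_n)` converges absolutely and
`|sR Σ_{n≥1} (K_n'(sR)/K_n(sR)) ω_n conj(φ_n)|
  ≤ (1 + |s|R) (Σ √(1+n²)|ω_n|²)^{1/2} (Σ √(1+n²)|φ_n|²)^{1/2}`. -/
theorem dtn_form_bounded (s : ℂ) (hs : 0 < s.re) (R : ℝ) (hR : 0 < R) (ω φ : ℕ → ℂ)
    (hω : Summable fun n : ℕ => Real.sqrt (1 + ((n : ℝ) + 1) ^ 2) * ‖ω (n + 1)‖ ^ 2)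
    (hφ : Summable fun n : ℕ => Real.sqrt (1 + ((n : ℝ) + 1) ^ 2) * ‖φ (n + 1)‖ ^ 2) :
    (Summable fun n : ℕ =>
      ‖besselK' ((n : ℝ) + 1) (s * R) / besselK ((n : ℝ) + 1) (s * R) * ω (n + 1) *
        (starRingEnd ℂ) (φ (n + 1))‖) ∧
    ‖s * (R : ℂ) * ∑' n : ℕ,
        besselK' ((n : ℝ) + 1) (s * R) / besselK ((n : ℝ) + 1) (s * R) * ω (n + 1) *
          (starRingEnd ℂ) (φ (n + 1))‖ ≤
      (1 + ‖s‖ * R) *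
        Real.sqrt (∑' n : ℕ, Real.sqrt (1 + ((n : ℝ) + 1) ^ 2) * ‖ω (n + 1)‖ ^ 2) *
        Real.sqrt (∑' n : ℕ, Real.sqrt (1 + ((n : ℝ) + 1) ^ 2) * ‖φ (n + 1)‖ ^ 2) := by
  have hz : 0 < (s * (R : ℂ)).re := by
    rw [Complex.re_mul_ofReal]; positivity
  have hzn : ‖s * (R : ℂ)‖ = ‖s‖ * R := by
    rw [norm_mul, Complex.norm_real, Real.norm_eq_abs, abs_of_pos hR]
  have hz0 : 0 < ‖s‖ * R := by
    rw [← hzn, norm_pos_iff]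
    intro h
    rw [h] at hz
    exact lt_irrefl _ hz
  set f : ℕ → ℝ := fun n => Real.sqrt (Real.sqrt (1 + ((n : ℝ) + 1) ^ 2)) * ‖ω (n + 1)‖ with hf
  set g : ℕ → ℝ := fun n => Real.sqrt (Real.sqrt (1 + ((n : ℝ) + 1) ^ 2)) * ‖φ (n + 1)‖ with hg
  have ef : ∀ n, f n ^ (2 : ℝ) = Real.sqrt (1 + ((n : ℝ) + 1) ^ 2) * ‖ω (n + 1)‖ ^ 2 := fun n => by
    rw [Real.rpow_two, hf, mul_pow, Real.sq_sqrt (Real.sqrt_nonneg _)]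
  have eg : ∀ n, g n ^ (2 : ℝ) = Real.sqrt (1 + ((n : ℝ) + 1) ^ 2) * ‖φ (n + 1)‖ ^ 2 := fun n => by
    rw [Real.rpow_two, hg, mul_pow, Real.sq_sqrt (Real.sqrt_nonneg _)]
  have CS := Real.summable_and_inner_le_Lp_mul_Lq_tsum_of_nonneg
    (Real.HolderConjugate.two_two) (f := f) (g := g)
    (fun n => by positivity) (fun n => by positivity)
    (by simpa only [ef] using hω) (by simpa only [eg] using hφ)
  simp only [ef, eg, ← Real.sqrt_eq_rpow] at CS
  obtain ⟨CS1, CS2⟩ := CS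
  have term : ∀ n : ℕ, ‖s * (R : ℂ) * (besselK' ((n : ℝ) + 1) (s * R) /
      besselK ((n : ℝ) + 1) (s * R) * ω (n + 1) * (starRingEnd ℂ) (φ (n + 1)))‖ ≤
      (1 + ‖s‖ * R) * (f n * g n) := by
    intro n
    have hb := bessel_bound _ hz ((n : ℝ) + 1) (by linarith [(Nat.cast_nonneg n : (0 : ℝ) ≤ n)])
    rw [hzn] at hb
    have w1 : (n : ℝ) + 1 ≤ Real.sqrt (1 + ((n : ℝ) + 1) ^ 2) :=
      Real.le_sqrt_of_sq_le (by linarith)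
    have w2 : 1 ≤ Real.sqrt (1 + ((n : ℝ) + 1) ^ 2) :=
      Real.le_sqrt_of_sq_le (by nlinarith)
    have efg : f n * g n =
        Real.sqrt (1 + ((n : ℝ) + 1) ^ 2) * (‖ω (n + 1)‖ * ‖φ (n + 1)‖) := by
      have := Real.mul_self_sqrt (Real.sqrt_nonneg (1 + ((n : ℝ) + 1) ^ 2))
      simp only [hf, hg]
      linear_combination (‖ω (n + 1)‖ * ‖φ (n + 1)‖) * this
    rw [efg, mul_assoc _ (ω (n + 1)), ← mul_assoc, norm_mul, norm_mul (ω (n + 1)),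
      RCLike.norm_conj, ← mul_assoc (1 + ‖s‖ * R)]
    refine mul_le_mul_of_nonneg_right (hb.trans ?_) (by positivity)
    nlinarith
  have sumz : Summable fun n : ℕ => ‖s * (R : ℂ) * (besselK' ((n : ℝ) + 1) (s * R) /
      besselK ((n : ℝ) + 1) (s * R) * ω (n + 1) * (starRingEnd ℂ) (φ (n + 1)))‖ :=
    Summable.of_nonneg_of_le (fun n => norm_nonneg _) term (CS1.mul_left _)
  refine ⟨?_, ?_⟩
  · refine (sumz.mul_left (‖s‖ * R)⁻¹).congr fun n => ?_
    rw [norm_mul (s * (R : ℂ)), hzn, inv_mul_cancel_left₀ hz0.ne']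
  · rw [← tsum_mul_left]
    refine (norm_tsum_le_tsum_norm sumz).trans ?_
    refine (sumz.tsum_le_tsum term (CS1.mul_left _)).trans ?_
    rw [tsum_mul_left, mul_assoc]
    gcongr
end

section
/- Let H be a complex Hilbert space, let σ ≥ 0 be a real number, let T > 0, and let u : [0,T] → H be continuously differentiable with u(0) = 0. Then for every t ∈ [0,T], σ‖u(t)‖ ≤ sup_{τ ∈ [0,T]} ‖u'(τ) + σ u(τ)‖. -/
open MeasureTheory

/-- Paper's Lemma 3.4 (Chen–Wu): for a continuously differentiable `H`-valued function `u`
on `[0,T]` with `u(0) = 0` and `σ ≥ 0`,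
`σ ‖u(t)‖ ≤ sup_{τ ∈ [0,T]} ‖u'(τ) + σ u(τ)‖` for every `t ∈ [0,T]`. -/
theorem sigma_u_le_sup (H : Type*) [NormedAddCommGroup H] [InnerProductSpace ℂ H]
    (σ T : ℝ) (hσ : 0 ≤ σ) (hT : 0 < T) (u u' : ℝ → H)
    (hderiv : ∀ t ∈ Set.Icc (0 : ℝ) T, HasDerivAt u (u' t) t)
    (hcont : ContinuousOn u' (Set.Icc (0 : ℝ) T))
    (h0 : u 0 = 0) :
    ∀ t ∈ Set.Icc (0 : ℝ) T,
      σ * ‖u t‖ ≤ ⨆ τ : Set.Icc (0 : ℝ) T, ‖u' τ + σ • u τ‖ := by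
  intro t ht
  set M : ℝ := ⨆ τ : Set.Icc (0 : ℝ) T, ‖u' τ + σ • u τ‖ with hM
  have hu : ContinuousOn u (Set.Icc (0 : ℝ) T) :=
    fun x hx => (hderiv x hx).continuousAt.continuousWithinAt
  have hbdd : BddAbove (Set.range fun τ : Set.Icc (0 : ℝ) T => ‖u' τ + σ • u τ‖) := by
    have hg : ContinuousOn (fun τ => ‖u' τ + σ • u τ‖) (Set.Icc (0 : ℝ) T) :=
      (hcont.add (hu.const_smul σ)).norm
    have h := isCompact_Icc.bddAbove_image hg
    rwa [Set.image_eq_range] at h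
  have hle : ∀ x ∈ Set.Icc (0 : ℝ) T, ‖u' x + σ • u x‖ ≤ M :=
    fun x hx => le_ciSup hbdd ⟨x, hx⟩
  have hM0 : 0 ≤ M := (norm_nonneg _).trans (hle t ht)
  have hexp : ∀ x : ℝ, HasDerivAt (fun x => Real.exp (σ * x)) (Real.exp (σ * x) * σ) x := by
    intro x
    simpa using ((hasDerivAt_id x).const_mul σ).exp
  have hf : ∀ x ∈ Set.Icc (0 : ℝ) T, HasDerivAt (fun x => Real.exp (σ * x) • (σ • u x))
      ((Real.exp (σ * x) * σ) • (u' x + σ • u x)) x := by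
    intro x hx
    have h := (hexp x).fun_smul ((hderiv x hx).fun_const_smul σ)
    convert h using 1
    simp only [smul_add, smul_smul]
  have key := image_norm_le_of_norm_deriv_right_le_deriv_boundary
    (f := fun x => Real.exp (σ * x) • (σ • u x))
    (f' := fun x => (Real.exp (σ * x) * σ) • (u' x + σ • u x)) (a := 0) (b := T)
    (B := fun x => M * (Real.exp (σ * x) - 1)) (B' := fun x => M * (Real.exp (σ * x) * σ))
    (fun x hx => (hf x hx).continuousAt.continuousWithinAt)
    (fun x hx => (hf x (Set.Ico_subset_Icc_self hx)).hasDerivWithinAt)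
    (by simp [h0])
    (fun x => ((hexp x).sub_const 1).const_mul M)
    (fun x hx => by
      have h1 : 0 ≤ Real.exp (σ * x) * σ := by positivity
      rw [norm_smul, Real.norm_of_nonneg h1, mul_comm M]
      exact mul_le_mul_of_nonneg_left (hle x (Set.Ico_subset_Icc_self hx)) h1)
    ht
  simp only [norm_smul, Real.norm_of_nonneg hσ, Real.norm_of_nonneg (Real.exp_pos _).le] at key
  have hpos := Real.exp_pos (σ * t)
  refine le_of_mul_le_mul_left ?_ hpos
  nlinarith
end

section
/- Let 0 < R < ρ, and for each integer n ≥ 1 set δ_n = (ρ - R)/√(1+n²). For each n ≥ 1 let χ_n : [R,ρ] → ℝ be a measurable function with 0 ≤ χ_n ≤ 1 and χ_n(r) = 0 for r ≤ ρ - δ_n. Let (c_n)_{n≥1} be complex numbers with Σ_{n≥1} (1+n²)^{-1/2} |c_n|² < ∞. Then the series Σ_{n≥1} c_n χ_n(r) sin(nθ) converges in L²((R,ρ)×(0,π); r dr dθ) and ∫₀^π ∫_R^ρ | Σ_{n=1}^∞ c_n χ_n(r) sin(nθ) |² r dr dθ ≤ (π/2) ρ (ρ - R) Σ_{n=1}^∞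 (1+n²)^{-1/2} |c_n|². -/
open MeasureTheory Filter

lemma aux_cos_int (k : ℤ) (hk : k ≠ 0) : ∫ θ in (0 : ℝ)..Real.pi, Real.cos ((k : ℝ) * θ) = 0 := by
  have hk' : (k : ℝ) ≠ 0 := by exact_mod_cast hk
  rw [intervalIntegral.integral_comp_mul_left (fun x => Real.cos x) hk', integral_cos]
  simp [Real.sin_int_mul_pi]

lemma aux_sin_sin (m n : ℕ) :
    ∫ θ in (0 : ℝ)..Real.pi, Real.sin (((m : ℝ) + 1) * θ) * Real.sin (((n : ℝ) + 1) * θ)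
      = if m = n then Real.pi / 2 else 0 := by
  have h : ∀ θ : ℝ, Real.sin (((m : ℝ) + 1) * θ) * Real.sin (((n : ℝ) + 1) * θ)
      = (1 / 2) * (Real.cos ((((m : ℤ) - n : ℤ) : ℝ) * θ)
        - Real.cos ((((m : ℤ) + n + 2 : ℤ) : ℝ) * θ)) := by
    intro θ
    have e1 : (((m : ℤ) - n : ℤ) : ℝ) * θ = ((m : ℝ) + 1) * θ - ((n : ℝ) + 1) * θ := by
      push_cast; ring
    have e2 : (((m : ℤ) + n + 2 : ℤ) : ℝ) * θ = ((m : ℝ) + 1) * θ + ((n : ℝ) + 1) * θ := by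
      push_cast; ring
    rw [e1, e2, Real.cos_sub, Real.cos_add]; ring
  simp_rw [h]
  rw [intervalIntegral.integral_const_mul, intervalIntegral.integral_sub
    (Continuous.intervalIntegrable (by fun_prop) _ _)
    (Continuous.intervalIntegrable (by fun_prop) _ _), aux_cos_int ((m : ℤ) + n + 2) (by omega)]
  split_ifs with hmn
  · subst hmn; simp; ring
  · rw [aux_cos_int _ (by omega)]; simp

lemma aux_real (K : ℕ) (b : ℕ → ℝ) :
    ∫ θ in (0 : ℝ)..Real.pi, (∑ n ∈ Finset.range K, b n * Real.sin (((n : ℝ) + 1) * θ)) ^ 2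
      = Real.pi / 2 * ∑ n ∈ Finset.range K, b n ^ 2 := by
  have h : ∀ θ : ℝ, (∑ n ∈ Finset.range K, b n * Real.sin (((n : ℝ) + 1) * θ)) ^ 2
      = ∑ m ∈ Finset.range K, ∑ n ∈ Finset.range K, (b m * b n) *
        (Real.sin (((m : ℝ) + 1) * θ) * Real.sin (((n : ℝ) + 1) * θ)) := by
    intro θ
    rw [sq, Finset.sum_mul_sum]
    refine Finset.sum_congr rfl fun m _ => Finset.sum_congr rfl fun n _ => by ring
  simp_rw [h]
  rw [intervalIntegral.integral_finsetSum
    (fun m _ => Continuous.intervalIntegrable (by fun_prop) _ _), Finset.mul_sum]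
  refine Finset.sum_congr rfl fun m hm => ?_
  rw [intervalIntegral.integral_finsetSum
    (fun m _ => Continuous.intervalIntegrable (by fun_prop) _ _)]
  simp_rw [intervalIntegral.integral_const_mul, aux_sin_sin]
  simp only [mul_ite, mul_zero, Finset.sum_ite_eq, hm, if_true]
  ring

lemma aux_cplx (K : ℕ) (a : ℕ → ℂ) :
    ∫ θ in (0 : ℝ)..Real.pi,
      ‖∑ n ∈ Finset.range K, a n * (Real.sin (((n : ℝ) + 1) * θ) : ℂ)‖ ^ 2
      = Real.pi / 2 * ∑ n ∈ Finset.range K, ‖a n‖ ^ 2 := by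
  have h : ∀ θ : ℝ, ‖∑ n ∈ Finset.range K, a n * (Real.sin (((n : ℝ) + 1) * θ) : ℂ)‖ ^ 2
      = (∑ n ∈ Finset.range K, (a n).re * Real.sin (((n : ℝ) + 1) * θ)) ^ 2
        + (∑ n ∈ Finset.range K, (a n).im * Real.sin (((n : ℝ) + 1) * θ)) ^ 2 := by
    intro θ
    rw [← Complex.normSq_eq_norm_sq, Complex.normSq_apply, Complex.re_sum, Complex.im_sum]
    simp only [Complex.re_mul_ofReal, Complex.im_mul_ofReal]
    ring
  simp_rw [h]
  rw [intervalIntegral.integral_add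
    (Continuous.intervalIntegrable (by fun_prop) _ _)
    (Continuous.intervalIntegrable (by fun_prop) _ _), aux_real, aux_real, ← mul_add,
    ← Finset.sum_add_distrib]
  congr 1
  refine Finset.sum_congr rfl fun n _ => ?_
  rw [← Complex.normSq_eq_norm_sq, Complex.normSq_apply]; ring

/-- For `r < ρ` only finitely many cutoffs are non-zero. -/
lemma aux_fin (R ρ : ℝ) (hRρ : R < ρ) (χ : ℕ → ℝ → ℝ)
    (hχsupp : ∀ n : ℕ, 1 ≤ n → ∀ r ∈ Set.Icc R ρ,
      r ≤ ρ - (ρ - R) / Real.sqrt (1 + (n : ℝ) ^ 2) → χ n r = 0)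
    (r : ℝ) (hr : r ∈ Set.Ioo R ρ) : ∃ K : ℕ, ∀ n, K ≤ n → χ (n + 1) r = 0 := by
  obtain ⟨K, hK⟩ := exists_nat_ge ((ρ - R) / (ρ - r))
  refine ⟨K, fun n hn => hχsupp (n + 1) (by omega) r ⟨hr.1.le, hr.2.le⟩ ?_⟩
  have h1 : (0 : ℝ) < ρ - r := sub_pos.2 hr.2
  have hn' : (K : ℝ) ≤ n := by exact_mod_cast hn
  have h2 : (ρ - R) / (ρ - r) ≤ Real.sqrt (1 + ((n + 1 : ℕ) : ℝ) ^ 2) := by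
    refine Real.le_sqrt_of_sq_le ?_
    have h3 : 0 ≤ (ρ - R) / (ρ - r) := div_nonneg (sub_pos.2 hRρ).le h1.le
    push_cast
    nlinarith
  have h4 : 0 < Real.sqrt (1 + ((n + 1 : ℕ) : ℝ) ^ 2) := Real.sqrt_pos.2 (by positivity)
  have h5 : (ρ - R) / Real.sqrt (1 + ((n + 1 : ℕ) : ℝ) ^ 2) ≤ ρ - r := by
    rw [div_le_iff₀ h4]
    rw [div_le_iff₀ h1] at h2
    linarith
  linarith

lemma aux_bound (R ρ : ℝ) (hR : 0 < R) (hRρ : R < ρ)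
    (χ : ℕ → ℝ → ℝ) (hχmeas : ∀ n : ℕ, 1 ≤ n → Measurable (χ n))
    (hχ0 : ∀ n : ℕ, 1 ≤ n → ∀ r ∈ Set.Icc R ρ, 0 ≤ χ n r)
    (hχ1 : ∀ n : ℕ, 1 ≤ n → ∀ r ∈ Set.Icc R ρ, χ n r ≤ 1)
    (hχsupp : ∀ n : ℕ, 1 ≤ n → ∀ r ∈ Set.Icc R ρ,
      r ≤ ρ - (ρ - R) / Real.sqrt (1 + (n : ℝ) ^ 2) → χ n r = 0)
    (c : ℕ → ℂ)
    (hc : Summable fun n : ℕ => (Real.sqrt (1 + ((n : ℝ) + 1) ^ 2))⁻¹ * ‖c (n + 1)‖ ^ 2) :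
    ∫ θ in (0 : ℝ)..Real.pi, ∫ r in R..ρ,
        ‖∑' n : ℕ,
            c (n + 1) * (χ (n + 1) r : ℂ) * (Real.sin (((n : ℝ) + 1) * θ) : ℂ)‖ ^ 2 * r ≤
      Real.pi / 2 * ρ * (ρ - R) *
        ∑' n : ℕ, (Real.sqrt (1 + ((n : ℝ) + 1) ^ 2))⁻¹ * ‖c (n + 1)‖ ^ 2 := by
  have hfin := aux_fin R ρ hRρ χ hχsupp
  have hρ : 0 < ρ := hR.trans hRρ
  have hRρ' : 0 < ρ - R := sub_pos.2 hRρ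
  simp_rw [intervalIntegral.integral_of_le hRρ.le, intervalIntegral.integral_of_le Real.pi_pos.le,
    integral_Ioc_eq_integral_Ioo (x := R) (y := ρ)]
  set F : ℝ → ℝ → ℂ := fun θ r => ∑' n : ℕ,
            c (n + 1) * (χ (n + 1) r : ℂ) * (Real.sin (((n : ℝ) + 1) * θ) : ℂ) with hF
  set μ := (volume : Measure ℝ).restrict (Set.Ioc 0 Real.pi) with hμ
  set ν := (volume : Measure ℝ).restrict (Set.Ioo R ρ) with hν
  set S := ∑' n : ℕ, (Real.sqrt (1 + ((n : ℝ) + 1) ^ 2))⁻¹ * ‖c (n + 1)‖ ^ 2 with hS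
  have hS0 : 0 ≤ S := tsum_nonneg fun n => by positivity
  have hB0 : 0 ≤ Real.pi / 2 * ρ * (ρ - R) * S := by positivity
  -- measurability
  have hFm : AEMeasurable (fun p : ℝ × ℝ => F p.1 p.2) (μ.prod ν) := by
    refine aemeasurable_of_tendsto_metrizable_ae (u := atTop)
      (f := fun N : ℕ => fun p : ℝ × ℝ => ∑ n ∈ Finset.range N,
        c (n + 1) * (χ (n + 1) p.2 : ℂ) * (Real.sin (((n : ℝ) + 1) * p.1) : ℂ)) ?_ ?_
    · intro N
      refine Measurable.aemeasurable ?_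
      refine Finset.measurable_fun_sum _ fun n _ => ?_
      have := hχmeas (n + 1) (by omega)
      fun_prop
    · rw [hμ, hν, Measure.prod_restrict]
      filter_upwards [ae_restrict_mem (measurableSet_Ioc.prod measurableSet_Ioo)] with p hp
      obtain ⟨K, hK⟩ := hfin p.2 hp.2
      refine (Summable.hasSum ?_).tendsto_sum_nat
      refine summable_of_ne_finset_zero (s := Finset.range K) fun n hn => ?_
      rw [hK n (by simpa using hn)]; simp
  have hfm : AEMeasurable (fun p : ℝ × ℝ => ‖‖F p.1 p.2‖ ^ 2 * p.2‖ₑ) (μ.prod ν) := by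
    have : AEMeasurable (fun p : ℝ × ℝ => ‖F p.1 p.2‖ ^ 2 * p.2) (μ.prod ν) :=
      (hFm.norm.pow_const 2).mul measurable_snd.aemeasurable
    exact this.enorm
  -- bound on the inner integral
  have hinner : ∀ r ∈ Set.Ioo R ρ, ∫⁻ θ, ‖‖F θ r‖ ^ 2 * r‖ₑ ∂μ ≤
      ∑' n : ℕ, (Set.Ioc (ρ - (ρ - R) / Real.sqrt (1 + ((n : ℝ) + 1) ^ 2)) ρ).indicator
        (fun _ => ENNReal.ofReal (Real.pi / 2 * ρ * ‖c (n + 1)‖ ^ 2)) r := by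
    intro r hr
    obtain ⟨K, hK⟩ := hfin r hr
    have hr0 : 0 < r := hR.trans hr.1
    have hFK : ∀ θ, F θ r = ∑ n ∈ Finset.range K,
        (c (n + 1) * (χ (n + 1) r : ℂ)) * (Real.sin (((n : ℝ) + 1) * θ) : ℂ) := by
      intro θ
      refine tsum_eq_sum fun n hn => ?_
      rw [hK n (by simpa using hn)]; simp
    have hint : Integrable (fun θ => ‖F θ r‖ ^ 2 * r) μ := by
      simp_rw [hFK]
      rw [hμ]
      refine IntegrableOn.mono_set (t := Set.Icc 0 Real.pi) ?_ Set.Ioc_subset_Icc_self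
      exact Continuous.integrableOn_Icc (by fun_prop)
    have h1 : ∫⁻ θ, ‖‖F θ r‖ ^ 2 * r‖ₑ ∂μ = ENNReal.ofReal (∫ θ, ‖F θ r‖ ^ 2 * r ∂μ) := by
      rw [← ofReal_integral_norm_eq_lintegral_enorm hint]
      congr 1
      refine integral_congr_ae (Eventually.of_forall fun θ => ?_)
      exact Real.norm_of_nonneg (by positivity)
    have h2 : ∫ θ, ‖F θ r‖ ^ 2 * r ∂μ =
        ∑ n ∈ Finset.range K, Real.pi / 2 * r * ‖c (n + 1) * (χ (n + 1) r : ℂ)‖ ^ 2 := by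
      rw [integral_mul_const]
      simp_rw [hFK]
      rw [hμ, ← intervalIntegral.integral_of_le Real.pi_pos.le,
        aux_cplx K (fun n => c (n + 1) * (χ (n + 1) r : ℂ)), ← Finset.mul_sum]
      ring
    rw [h1, h2, ENNReal.ofReal_sum_of_nonneg (fun n _ => by positivity)]
    refine le_trans (Finset.sum_le_sum fun n _ => ?_) (ENNReal.sum_le_tsum (Finset.range K))
    by_cases hm : r ∈ Set.Ioc (ρ - (ρ - R) / Real.sqrt (1 + ((n : ℝ) + 1) ^ 2)) ρ
    · rw [Set.indicator_of_mem hm]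
      refine ENNReal.ofReal_le_ofReal ?_
      have hx0 := hχ0 (n + 1) (by omega) r ⟨hr.1.le, hr.2.le⟩
      have hx1 := hχ1 (n + 1) (by omega) r ⟨hr.1.le, hr.2.le⟩
      have : ‖c (n + 1) * (χ (n + 1) r : ℂ)‖ ≤ ‖c (n + 1)‖ := by
        rw [norm_mul, Complex.norm_real, Real.norm_of_nonneg hx0]
        exact mul_le_of_le_one_right (norm_nonneg _) hx1
      have := hr.2.le
      gcongr
    · have hz : χ (n + 1) r = 0 := by
        refine hχsupp (n + 1) (by omega) r ⟨hr.1.le, hr.2.le⟩ ?_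
        push_cast
        by_contra hcon
        exact hm ⟨not_le.1 hcon, hr.2.le⟩
      simp [hz]
  have key : ∫⁻ θ, ∫⁻ r, ‖‖F θ r‖ ^ 2 * r‖ₑ ∂ν ∂μ ≤
      ENNReal.ofReal (Real.pi / 2 * ρ * (ρ - R) * S) := by
    rw [lintegral_lintegral_swap hfm]
    calc ∫⁻ r, ∫⁻ θ, ‖‖F θ r‖ ^ 2 * r‖ₑ ∂μ ∂ν
        ≤ ∫⁻ r, ∑' n : ℕ,
          (Set.Ioc (ρ - (ρ - R) / Real.sqrt (1 + ((n : ℝ) + 1) ^ 2)) ρ).indicator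
          (fun _ => ENNReal.ofReal (Real.pi / 2 * ρ * ‖c (n + 1)‖ ^ 2)) r ∂ν := by
          refine lintegral_mono_ae ?_
          filter_upwards [ae_restrict_mem measurableSet_Ioo] with r hr using hinner r hr
      _ ≤ ∫⁻ r, ∑' n : ℕ,
          (Set.Ioc (ρ - (ρ - R) / Real.sqrt (1 + ((n : ℝ) + 1) ^ 2)) ρ).indicator
          (fun _ => ENNReal.ofReal (Real.pi / 2 * ρ * ‖c (n + 1)‖ ^ 2)) r :=
          lintegral_mono' Measure.restrict_le_self le_rfl
      _ = ∑' n : ℕ, ENNReal.ofReal (Real.pi / 2 * ρ * (ρ - R) *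
            ((Real.sqrt (1 + ((n : ℝ) + 1) ^ 2))⁻¹ * ‖c (n + 1)‖ ^ 2)) := by
          rw [lintegral_tsum fun n =>
            (measurable_const.indicator measurableSet_Ioc).aemeasurable]
          refine tsum_congr fun n => ?_
          rw [lintegral_indicator_const measurableSet_Ioc, Real.volume_Ioc,
            ← ENNReal.ofReal_mul (by positivity)]
          congr 1
          rw [div_eq_mul_inv]
          ring
      _ = ENNReal.ofReal (Real.pi / 2 * ρ * (ρ - R) * S) := by
          rw [hS, ← tsum_mul_left, ENNReal.ofReal_tsum_of_nonneg (fun n => by positivity)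
            (hc.mul_left _)]
  have hfinal : ‖∫ θ, ∫ r, ‖F θ r‖ ^ 2 * r ∂ν ∂μ‖ₑ ≤
      ENNReal.ofReal (Real.pi / 2 * ρ * (ρ - R) * S) :=
    (enorm_integral_le_lintegral_enorm _).trans
      ((lintegral_mono fun θ => enorm_integral_le_lintegral_enorm _).trans key)
  rw [← ofReal_norm, ENNReal.ofReal_le_ofReal_iff hB0] at hfinal
  exact (Real.le_norm_self _).trans hfinal

/-- Key computation in the paper's trace Lemma 4.1, estimate (4.2). Coefficients are
indexed by `n ≥ 1` (here `n + 1` with `n : ℕ`): with cutoffs `χ_n` supported in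
`(ρ - δ_n, ρ]`, `δ_n = (ρ-R)/√(1+n²)`, the series `Σ c_n χ_n(r) sin(nθ)` converges in
`L²((R,ρ)×(0,π); r dr dθ)` and
`∫₀^π ∫_R^ρ |Σ c_n χ_n(r) sin(nθ)|² r dr dθ ≤ (π/2) ρ (ρ-R) Σ (1+n²)^{-1/2} |c_n|²`. -/
theorem trace_extension_L2_bound (R ρ : ℝ) (hR : 0 < R) (hRρ : R < ρ)
    (χ : ℕ → ℝ → ℝ) (hχmeas : ∀ n : ℕ, 1 ≤ n → Measurable (χ n))
    (hχ0 : ∀ n : ℕ, 1 ≤ n → ∀ r ∈ Set.Icc R ρ, 0 ≤ χ n r)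
    (hχ1 : ∀ n : ℕ, 1 ≤ n → ∀ r ∈ Set.Icc R ρ, χ n r ≤ 1)
    (hχsupp : ∀ n : ℕ, 1 ≤ n → ∀ r ∈ Set.Icc R ρ,
      r ≤ ρ - (ρ - R) / Real.sqrt (1 + (n : ℝ) ^ 2) → χ n r = 0)
    (c : ℕ → ℂ)
    (hc : Summable fun n : ℕ => (Real.sqrt (1 + ((n : ℝ) + 1) ^ 2))⁻¹ * ‖c (n + 1)‖ ^ 2) :
    Tendsto (fun N : ℕ =>
        ∫ θ in (0 : ℝ)..Real.pi, ∫ r in R..ρ,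
          ‖(∑ n ∈ Finset.range N,
              c (n + 1) * (χ (n + 1) r : ℂ) * (Real.sin (((n : ℝ) + 1) * θ) : ℂ)) -
            ∑' n : ℕ,
              c (n + 1) * (χ (n + 1) r : ℂ) * (Real.sin (((n : ℝ) + 1) * θ) : ℂ)‖ ^ 2 * r)
      atTop (nhds 0) ∧
    ∫ θ in (0 : ℝ)..Real.pi, ∫ r in R..ρ,
        ‖∑' n : ℕ,
            c (n + 1) * (χ (n + 1) r : ℂ) * (Real.sin (((n : ℝ) + 1) * θ) : ℂ)‖ ^ 2 * r ≤
      Real.pi / 2 * ρ * (ρ - R) *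
        ∑' n : ℕ, (Real.sqrt (1 + ((n : ℝ) + 1) ^ 2))⁻¹ * ‖c (n + 1)‖ ^ 2 := by
  refine ⟨?_, aux_bound R ρ hR hRρ χ hχmeas hχ0 hχ1 hχsupp c hc⟩
  have hfin := aux_fin R ρ hRρ χ hχsupp
  set w : ℕ → ℝ := fun n => (Real.sqrt (1 + ((n : ℝ) + 1) ^ 2))⁻¹ * ‖c (n + 1)‖ ^ 2 with hw
  have hlim : Tendsto (fun N : ℕ => Real.pi / 2 * ρ * (ρ - R) *
      (∑' n, w n - ∑ n ∈ Finset.range N, w n)) atTop (nhds 0) := by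
    have := (hc.hasSum.tendsto_sum_nat.const_sub (∑' n, w n)).const_mul
      (Real.pi / 2 * ρ * (ρ - R))
    simpa using this
  refine squeeze_zero (fun N => ?_) (fun N => ?_) hlim
  · refine intervalIntegral.integral_nonneg Real.pi_pos.le fun θ _ => ?_
    refine intervalIntegral.integral_nonneg hRρ.le fun r hr => ?_
    have := hR.le.trans hr.1
    positivity
  · -- apply the bound to the tail coefficients
    set d : ℕ → ℂ := fun n => if n < N + 1 then 0 else c n with hd
    have hdw : ∀ n : ℕ, (Real.sqrt (1 + ((n : ℝ) + 1) ^ 2))⁻¹ * ‖d (n + 1)‖ ^ 2 =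
        w n - if n ∈ Finset.range N then w n else 0 := by
      intro n
      by_cases h : n < N <;> simp [hd, hw, h]
    have hfs : HasSum (fun n => if n ∈ Finset.range N then w n else 0)
        (∑ n ∈ Finset.range N, w n) := by
      have := hasSum_sum_of_ne_finset_zero (s := Finset.range N)
        (f := fun n => if n ∈ Finset.range N then w n else 0)
        (L := SummationFilter.unconditional ℕ) (fun n hn => if_neg hn)
      convert this using 1
      exact Finset.sum_congr rfl fun n hn => (if_pos hn).symm
    have hds := hc.hasSum.sub hfs
    have hds' : HasSum (fun n : ℕ => (Real.sqrt (1 + ((n : ℝ) + 1) ^ 2))⁻¹ * ‖d (n + 1)‖ ^ 2)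
        (∑' n, w n - ∑ n ∈ Finset.range N, w n) := by
      simpa only [hdw] using hds
    have hb := aux_bound R ρ hR hRρ χ hχmeas hχ0 hχ1 hχsupp d hds'.summable
    rw [hds'.tsum_eq] at hb
    refine le_trans (le_of_eq ?_) hb
    refine intervalIntegral.integral_congr fun θ _ => ?_
    simp only [intervalIntegral.integral_of_le hRρ.le, integral_Ioc_eq_integral_Ioo]
    refine setIntegral_congr_fun measurableSet_Ioo fun r hr => ?_
    obtain ⟨K, hK⟩ := hfin r hr
    have e1 : ∀ (a : ℕ → ℂ), ∑' n : ℕ,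
        a (n + 1) * (χ (n + 1) r : ℂ) * (Real.sin (((n : ℝ) + 1) * θ) : ℂ) =
        ∑ n ∈ Finset.range (N + K),
          a (n + 1) * (χ (n + 1) r : ℂ) * (Real.sin (((n : ℝ) + 1) * θ) : ℂ) := by
      intro a
      refine tsum_eq_sum fun n hn => ?_
      rw [hK n (by have : N + K ≤ n := by simpa using hn
                   omega)]
      simp
    beta_reduce
    rw [e1 c, e1 d, Finset.sum_range_add, Finset.sum_range_add, sub_add_cancel_left, norm_neg]
    have z : ∑ n ∈ Finset.range N,
        d (n + 1) * (χ (n + 1) r : ℂ) * (Real.sin (((n : ℝ) + 1) * θ) : ℂ) = 0 := by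
      refine Finset.sum_eq_zero fun n hn => ?_
      have : n < N := by simpa using hn
      simp [hd, this]
    rw [z, zero_add]
    simp [hd]
end

section
/- Let 0 < R < ρ, and for each integer n ≥ 1 set δ_n = (ρ - R)/√(1+n²). Let C₀ > 0, and for each n ≥ 1 let χ_n : [R,ρ] → ℝ be continuously differentiable with 0 ≤ χ_n ≤ 1, χ_n(r) = 0 and χ_n'(r) = 0 for r ≤ ρ - δ_n, and |χ_n'(r)| ≤ C₀ / δ_n for all r ∈ [R,ρ]. Let (c_n)_{n≥1} be complex numbers with Σ_{n≥1} √(1+n²) |c_n|² < ∞. Then ∫₀^π ∫_R^ρ ( | Σ_{n=1}^∞ c_n χ_n'(r) sin(nθ) |² + r^{-2} | Σ_{n=1}^∞ c_n χ_n(r) n cos(nθ) |² ) r dr dθ ≤ (π/2) ( C₀² ρ/(ρ - R) + (ρ - R)/R ) Σ_{n=1}^∞ √(1+n²) |c_n|², where both series converge in the corresponding weighted L² spaces. -/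
open MeasureTheory Filter

lemma aux_bessel (e : ℕ → ℝ → ℝ) (he : ∀ n, Continuous (e n))
    (horth : ∀ n m, ∫ θ in (0:ℝ)..Real.pi, e n θ * e m θ = if n = m then Real.pi / 2 else 0)
    (s : Finset ℕ) (a : ℕ → ℂ) :
    ∫⁻ θ in Set.Ioc 0 Real.pi, ‖∑ n ∈ s, a n * (e n θ : ℂ)‖ₑ ^ 2 =
      ENNReal.ofReal (Real.pi / 2) * ∑ n ∈ s, ‖a n‖ₑ ^ 2 := by
  have hexp : ∀ θ, ‖∑ n ∈ s, a n * (e n θ : ℂ)‖ ^ 2 =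
      ∑ n ∈ s, ∑ m ∈ s, ((a n).re * (a m).re + (a n).im * (a m).im) * (e n θ * e m θ) := by
    intro θ
    rw [Complex.sq_norm, Complex.normSq_apply]
    simp only [Complex.re_sum, Complex.im_sum, Complex.re_mul_ofReal, Complex.im_mul_ofReal]
    rw [Finset.sum_mul_sum, Finset.sum_mul_sum, ← Finset.sum_add_distrib]
    refine Finset.sum_congr rfl fun n _ => ?_
    rw [← Finset.sum_add_distrib]
    refine Finset.sum_congr rfl fun m _ => ?_
    ring
  have hint : ∫ θ in (0:ℝ)..Real.pi, ‖∑ n ∈ s, a n * (e n θ : ℂ)‖ ^ 2 =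
      Real.pi / 2 * ∑ n ∈ s, ‖a n‖ ^ 2 := by
    simp_rw [hexp]
    rw [intervalIntegral.integral_finsetSum]
    · rw [Finset.mul_sum]
      refine Finset.sum_congr rfl fun n hn => ?_
      rw [intervalIntegral.integral_finsetSum]
      · simp_rw [intervalIntegral.integral_const_mul, horth]
        simp only [mul_ite, mul_zero, Finset.sum_ite_eq, hn, if_true]
        rw [Complex.sq_norm, Complex.normSq_apply]
        ring
      · intro m _
        exact (continuous_const.mul ((he n).mul (he m))).intervalIntegrable _ _
    · intro n _
      exact (continuous_finsetSum _ fun m _ =>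
        continuous_const.mul ((he n).mul (he m))).intervalIntegrable _ _
  have hc : Continuous fun θ => ‖∑ n ∈ s, a n * (e n θ : ℂ)‖ ^ 2 := by
    refine (Continuous.norm ?_).pow 2
    exact continuous_finsetSum _ fun m _ =>
        continuous_const.mul (Complex.continuous_ofReal.comp (he m))
  have h1 : ∀ z : ℂ, ‖z‖ₑ ^ 2 = ENNReal.ofReal (‖z‖ ^ 2) := by
    intro z
    rw [← ofReal_norm, ENNReal.ofReal_pow (norm_nonneg _)]
  simp_rw [h1]
  rw [← ENNReal.ofReal_sum_of_nonneg (fun _ _ => by positivity),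
    ← ENNReal.ofReal_mul (by positivity), ← hint,
    intervalIntegral.integral_of_le Real.pi_pos.le,
    ofReal_integral_eq_lintegral_ofReal]
  · exact (intervalIntegrable_iff_integrableOn_Ioc_of_le Real.pi_pos.le).1
      (hc.intervalIntegrable _ _)
  · exact ae_of_all _ fun _ => by positivity

lemma aux_meas (e : ℕ → ℝ → ℝ) (he : ∀ n, Continuous (e n))
    (φ : ℕ → ℝ → ℂ) (hφ : ∀ n, Measurable (φ n))
    (hfin : ∀ r, ∃ N, ∀ n, N ≤ n → φ n r = 0)
    (v : ℝ → ENNReal) (hv : Measurable v) :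
    Measurable (Function.uncurry fun θ r => ‖∑' n, φ n r * (e n θ : ℂ)‖ₑ ^ 2 * v r) := by
  have h : Measurable (fun p : ℝ × ℝ => ∑' n, φ n p.2 * (e n p.1 : ℂ)) := by
    refine measurable_of_tendsto_metrizable
      (f := fun N (p : ℝ × ℝ) => ∑ n ∈ Finset.range N, φ n p.2 * (e n p.1 : ℂ)) ?_ ?_
    · intro N
      refine Finset.measurable_fun_sum _ fun n _ => ?_
      exact ((hφ n).comp measurable_snd).mul
        (Complex.measurable_ofReal.comp ((he n).measurable.comp measurable_fst))
    · rw [tendsto_pi_nhds]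
      intro p
      obtain ⟨N, hN⟩ := hfin p.2
      refine (Summable.hasSum ?_).tendsto_sum_nat
      refine summable_of_ne_finset_zero (s := Finset.range N) fun n hn => ?_
      rw [hN n (by simpa using hn), zero_mul]
  exact (h.enorm.pow_const 2).mul (hv.comp measurable_snd)

lemma aux_core (e : ℕ → ℝ → ℝ) (he : ∀ n, Continuous (e n))
    (horth : ∀ n m, ∫ θ in (0:ℝ)..Real.pi, e n θ * e m θ = if n = m then Real.pi / 2 else 0)
    (φ : ℕ → ℝ → ℂ) (hφ : ∀ n, Measurable (φ n))
    (hfin : ∀ r, ∃ N, ∀ n, N ≤ n → φ n r = 0)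
    (v : ℝ → ENNReal) (hv : Measurable v) (μ : Measure ℝ) [SFinite μ] :
    ∫⁻ θ in Set.Ioc 0 Real.pi, ∫⁻ r, ‖∑' n, φ n r * (e n θ : ℂ)‖ₑ ^ 2 * v r ∂μ =
      ENNReal.ofReal (Real.pi / 2) * ∑' n, ∫⁻ r, ‖φ n r‖ₑ ^ 2 * v r ∂μ := by
  have hm := aux_meas e he φ hφ hfin v hv
  rw [lintegral_lintegral_swap hm.aemeasurable, ← lintegral_tsum, ← lintegral_const_mul]
  rotate_left
  · exact Measurable.ennreal_tsum fun n => ((hφ n).enorm.pow_const 2).mul hv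
  · exact fun n => (((hφ n).enorm.pow_const 2).mul hv).aemeasurable
  refine lintegral_congr fun r => ?_
  obtain ⟨N, hN⟩ := hfin r
  have h1 : ∀ θ, ∑' n, φ n r * (e n θ : ℂ) = ∑ n ∈ Finset.range N, φ n r * (e n θ : ℂ) := by
    intro θ
    refine tsum_eq_sum fun n hn => ?_
    rw [hN n (by simpa using hn), zero_mul]
  have h2 : ∑' n, ‖φ n r‖ₑ ^ 2 * v r = ∑ n ∈ Finset.range N, ‖φ n r‖ₑ ^ 2 * v r := by
    refine tsum_eq_sum fun n hn => ?_
    rw [hN n (by simpa using hn)]; simp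
  simp_rw [h1]
  rw [h2, lintegral_mul_const, aux_bessel e he horth (Finset.range N) (fun n => φ n r),
    ← Finset.sum_mul, mul_assoc]
  refine (Measurable.enorm ?_).pow_const 2
  refine Finset.measurable_fun_sum _ fun n _ => ?_
  exact measurable_const.mul (Complex.measurable_ofReal.comp (he n).measurable)

lemma aux_iter (R ρ : ℝ) (hRρ : R < ρ) (f : ℝ → ℝ → ℝ) (F : ℝ → ℝ → ENNReal)
    (h : ∀ θ, ∀ r ∈ Set.Ioo R ρ, ‖f θ r‖ₑ ≤ F θ r) :
    ‖∫ θ in (0:ℝ)..Real.pi, ∫ r in R..ρ, f θ r‖ₑ ≤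
      ∫⁻ θ in Set.Ioc 0 Real.pi, ∫⁻ r in Set.Ioo R ρ, F θ r := by
  rw [intervalIntegral.integral_of_le Real.pi_pos.le]
  refine (enorm_integral_le_lintegral_enorm _).trans (lintegral_mono fun θ => ?_)
  rw [intervalIntegral.integral_of_le hRρ.le, integral_Ioc_eq_integral_Ioo]
  refine (enorm_integral_le_lintegral_enorm _).trans ?_
  exact setLIntegral_mono' measurableSet_Ioo fun r hr => h θ r hr

lemma aux_coef (R ρ δ M V B : ℝ) (hδ : 0 < δ) (hM : 0 ≤ M) (hV : 0 ≤ V) (φ : ℝ → ℂ) (w : ℝ → ℝ)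
    (h0 : ∀ r ∈ Set.Ioo R ρ, r ≤ ρ - δ → φ r = 0)
    (h1 : ∀ r ∈ Set.Ioo R ρ, ‖φ r‖ ≤ M) (hw : ∀ r ∈ Set.Ioo R ρ, |w r| ≤ V)
    (hB : M ^ 2 * V * δ ≤ B) :
    ∫⁻ r in Set.Ioo R ρ, ‖φ r‖ₑ ^ 2 * ‖w r‖ₑ ≤ ENNReal.ofReal B := by
  calc _ ≤ ∫⁻ r in Set.Ioo R ρ, (Set.Ioo (ρ - δ) ρ).indicator
        (fun _ => ENNReal.ofReal (M ^ 2 * V)) r := by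
        refine setLIntegral_mono' measurableSet_Ioo fun r hr => ?_
        by_cases hr' : r ≤ ρ - δ
        · simp [h0 r hr hr']
        · rw [Set.indicator_of_mem (show r ∈ Set.Ioo (ρ - δ) ρ from ⟨not_le.1 hr', hr.2⟩), ← ofReal_norm, ← ofReal_norm,
            ← ENNReal.ofReal_pow (norm_nonneg _), ← ENNReal.ofReal_mul (by positivity)]
          refine ENNReal.ofReal_le_ofReal ?_
          have := h1 r hr
          have := hw r hr
          rw [Real.norm_eq_abs]
          gcongr
    _ ≤ ∫⁻ r, (Set.Ioo (ρ - δ) ρ).indicator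
        (fun _ => ENNReal.ofReal (M ^ 2 * V)) r := setLIntegral_le_lintegral _ _
    _ = ENNReal.ofReal (M ^ 2 * V * δ) := by
        rw [lintegral_indicator measurableSet_Ioo, setLIntegral_const, Real.volume_Ioo,
          sub_sub_cancel, ← ENNReal.ofReal_mul (by positivity)]
    _ ≤ _ := ENNReal.ofReal_le_ofReal hB

lemma aux_master (R ρ : ℝ) (hRρ : R < ρ) (e : ℕ → ℝ → ℝ) (he : ∀ n, Continuous (e n))
    (horth : ∀ n m, ∫ θ in (0:ℝ)..Real.pi, e n θ * e m θ = if n = m then Real.pi / 2 else 0)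
    (φ : ℕ → ℝ → ℂ) (hφ : ∀ n, ContinuousOn (φ n) (Set.Ioo R ρ))
    (w : ℝ → ℝ) (hwm : Measurable w) (δ M a : ℕ → ℝ) (V K : ℝ)
    (hδ : ∀ n, 0 < δ n) (hδ0 : Tendsto δ atTop (nhds 0)) (hM : ∀ n, 0 ≤ M n) (hV : 0 ≤ V)
    (h0 : ∀ n, ∀ r ∈ Set.Ioo R ρ, r ≤ ρ - δ n → φ n r = 0)
    (h1 : ∀ n, ∀ r ∈ Set.Ioo R ρ, ‖φ n r‖ ≤ M n) (hw : ∀ r ∈ Set.Ioo R ρ, |w r| ≤ V)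
    (hK : 0 ≤ K) (ha : ∀ n, 0 ≤ a n) (has : Summable a)
    (hB : ∀ n, M n ^ 2 * V * δ n ≤ K * a n) :
    Tendsto (fun N : ℕ => ∫ θ in (0 : ℝ)..Real.pi, ∫ r in R..ρ,
          ‖(∑ n ∈ Finset.range N, φ n r * (e n θ : ℂ)) - ∑' n : ℕ, φ n r * (e n θ : ℂ)‖ ^ 2 * w r)
      atTop (nhds 0) ∧
    ∃ F : ℝ → ℝ → ENNReal, Measurable (Function.uncurry F) ∧
      (∀ θ, ∀ r ∈ Set.Ioo R ρ, F θ r = ‖∑' n : ℕ, φ n r * (e n θ : ℂ)‖ₑ ^ 2 * ‖w r‖ₑ) ∧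
      ∫⁻ θ in Set.Ioc 0 Real.pi, ∫⁻ r in Set.Ioo R ρ, F θ r ≤
        ENNReal.ofReal (Real.pi / 2 * K * ∑' n, a n) := by
  set ψ : ℕ → ℝ → ℂ := fun n => (Set.Ioo R ρ).indicator (φ n) with hψ
  have hψm : ∀ n, Measurable (ψ n) := fun n => by
    have := (hφ n).measurable_piecewise (continuousOn_const (c := (0:ℂ))) measurableSet_Ioo
    have h2 : ψ n = (Set.Ioo R ρ).piecewise (φ n) fun _ => 0 :=
      (Set.piecewise_eq_indicator).symm
    rw [h2]
    exact this
  have hψe : ∀ n, ∀ r ∈ Set.Ioo R ρ, ψ n r = φ n r := fun n r hr => Set.indicator_of_mem hr _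
  have hfin : ∀ r, ∃ N, ∀ n, N ≤ n → ψ n r = 0 := by
    intro r
    by_cases hr : r ∈ Set.Ioo R ρ
    · obtain ⟨N, hN⟩ := eventually_atTop.1 (hδ0.eventually (gt_mem_nhds (sub_pos.2 hr.2)))
      refine ⟨N, fun n hn => ?_⟩
      rw [hψe n r hr]
      exact h0 n r hr (by have := hN n hn; linarith)
    · exact ⟨0, fun n _ => Set.indicator_of_notMem hr _⟩
  have hv : Measurable fun r => ‖w r‖ₑ := hwm.enorm
  have hcoef : ∀ n, ∫⁻ r in Set.Ioo R ρ, ‖ψ n r‖ₑ ^ 2 * ‖w r‖ₑ ≤ ENNReal.ofReal (K * a n) := by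
    intro n
    refine aux_coef R ρ (δ n) (M n) V _ (hδ n) (hM n) hV _ w ?_ ?_ hw (hB n)
    · intro r hr h; rw [hψe n r hr]; exact h0 n r hr h
    · intro r hr; rw [hψe n r hr]; exact h1 n r hr
  have hfinN : ∀ N r, ∃ N', ∀ n, N' ≤ n → ψ (n + N) r = 0 := fun N r => by
    obtain ⟨N', h⟩ := hfin r
    exact ⟨N', fun n hn => h _ (by omega)⟩
  have hbd : ∀ N, ∫⁻ θ in Set.Ioc 0 Real.pi, ∫⁻ r in Set.Ioo R ρ,
      ‖∑' n, ψ (n + N) r * (e (n + N) θ : ℂ)‖ₑ ^ 2 * ‖w r‖ₑ ≤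
        ENNReal.ofReal (Real.pi / 2 * K * ∑' n, a (n + N)) := by
    intro N
    rw [aux_core (fun n => e (n + N)) (fun n => he _) (fun n m => by simp [horth])
      (fun n => ψ (n + N)) (fun n => hψm _) (hfinN N) _ hv]
    rw [mul_assoc, ENNReal.ofReal_mul (by positivity), ← tsum_mul_left,
      ENNReal.ofReal_tsum_of_nonneg (fun n => mul_nonneg hK (ha _))
        (((summable_nat_add_iff N).2 has).mul_left K)]
    gcongr with n
    exact hcoef _
  refine ⟨?_, fun θ r => ‖∑' n, ψ n r * (e n θ : ℂ)‖ₑ ^ 2 * ‖w r‖ₑ,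
    aux_meas e he ψ hψm hfin _ hv, ?_, by simpa using hbd 0⟩
  · have hlim : Tendsto (fun N => Real.pi / 2 * K * ∑' n, a (n + N)) atTop (nhds 0) := by
      simpa using (tendsto_sum_nat_add a).const_mul (Real.pi / 2 * K)
    refine squeeze_zero_norm (fun N => ?_) hlim
    have hnn : 0 ≤ Real.pi / 2 * K * ∑' n, a (n + N) :=
      mul_nonneg (by positivity) (tsum_nonneg fun n => ha _)
    rw [← ENNReal.ofReal_le_ofReal_iff hnn, ofReal_norm]
    refine (aux_iter R ρ hRρ _ _ ?_).trans (hbd N)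
    intro θ r hr
    have hs : Summable fun n => φ n r * (e n θ : ℂ) := by
      obtain ⟨N', h⟩ := hfin r
      refine summable_of_ne_finset_zero (s := Finset.range N') fun n hn => ?_
      rw [← hψe n r hr, h n (by simpa using hn), zero_mul]
    simp only [hψe _ r hr]
    rw [← hs.sum_add_tsum_nat_add N, sub_add_cancel_left, norm_neg, enorm_mul, enorm_pow,
      enorm_norm]
  · intro θ r hr
    simp only [hψe _ r hr]

lemma aux_cosint (k : ℤ) :
    ∫ θ in (0:ℝ)..Real.pi, Real.cos ((k:ℝ) * θ) = if k = 0 then Real.pi else 0 := by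
  split_ifs with h
  · simp [h]
  · have hk : (k:ℝ) ≠ 0 := by exact_mod_cast h
    rw [intervalIntegral.integral_comp_mul_left _ hk, integral_cos]
    simp [Real.sin_int_mul_pi]

lemma aux_sin (n m : ℕ) : ∫ θ in (0:ℝ)..Real.pi,
    Real.sin (((n:ℝ) + 1) * θ) * Real.sin (((m:ℝ) + 1) * θ) =
      if n = m then Real.pi / 2 else 0 := by
  have h : ∀ θ : ℝ, Real.sin (((n:ℝ) + 1) * θ) * Real.sin (((m:ℝ) + 1) * θ) =
      (1/2) * (Real.cos ((((n:ℤ) - m : ℤ) : ℝ) * θ) - Real.cos ((((n:ℤ) + m + 2 : ℤ) : ℝ) * θ)) := by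
    intro θ
    have e1 : (((n:ℤ) - m : ℤ) : ℝ) * θ = ((n:ℝ) + 1) * θ - ((m:ℝ) + 1) * θ := by push_cast; ring
    have e2 : (((n:ℤ) + m + 2 : ℤ) : ℝ) * θ = ((n:ℝ) + 1) * θ + ((m:ℝ) + 1) * θ := by
      push_cast; ring
    rw [e1, e2, Real.cos_sub, Real.cos_add]; ring
  simp_rw [h]
  rw [intervalIntegral.integral_const_mul, intervalIntegral.integral_sub
    (Continuous.intervalIntegrable (by fun_prop) _ _)
    (Continuous.intervalIntegrable (by fun_prop) _ _), aux_cosint, aux_cosint,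
    if_neg (show ((n:ℤ) + m + 2) ≠ 0 by omega)]
  by_cases hnm : n = m
  · simp [hnm]; ring
  · rw [if_neg (by omega), if_neg hnm]; simp

lemma aux_cos (n m : ℕ) : ∫ θ in (0:ℝ)..Real.pi,
    Real.cos (((n:ℝ) + 1) * θ) * Real.cos (((m:ℝ) + 1) * θ) =
      if n = m then Real.pi / 2 else 0 := by
  have h : ∀ θ : ℝ, Real.cos (((n:ℝ) + 1) * θ) * Real.cos (((m:ℝ) + 1) * θ) =
      (1/2) * (Real.cos ((((n:ℤ) - m : ℤ) : ℝ) * θ) + Real.cos ((((n:ℤ) + m + 2 : ℤ) : ℝ) * θ)) := by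
    intro θ
    have e1 : (((n:ℤ) - m : ℤ) : ℝ) * θ = ((n:ℝ) + 1) * θ - ((m:ℝ) + 1) * θ := by push_cast; ring
    have e2 : (((n:ℤ) + m + 2 : ℤ) : ℝ) * θ = ((n:ℝ) + 1) * θ + ((m:ℝ) + 1) * θ := by
      push_cast; ring
    rw [e1, e2, Real.cos_sub, Real.cos_add]; ring
  simp_rw [h]
  rw [intervalIntegral.integral_const_mul, intervalIntegral.integral_add
    (Continuous.intervalIntegrable (by fun_prop) _ _)
    (Continuous.intervalIntegrable (by fun_prop) _ _), aux_cosint, aux_cosint,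
    if_neg (show ((n:ℤ) + m + 2) ≠ 0 by omega)]
  by_cases hnm : n = m
  · simp [hnm]; ring
  · rw [if_neg (by omega), if_neg hnm]; simp


/-- Key computation behind the paper's trace Lemma 4.1, estimate (4.3). Coefficients are
indexed by `n ≥ 1` (here `n + 1` with `n : ℕ`): with `C¹` cutoffs `χ_n` supported in
`(ρ - δ_n, ρ]`, `δ_n = (ρ-R)/√(1+n²)`, `|χ_n'| ≤ C₀/δ_n`, the squared polar gradient of
`ζ(r,θ) = Σ c_n χ_n(r) sin(nθ)` satisfies
`∫₀^π ∫_R^ρ (|Σ c_n χ_n'(r) sin(nθ)|² + r⁻²|Σ c_n χ_n(r) n cos(nθ)|²) r dr dθ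
  ≤ (π/2)(C₀² ρ/(ρ-R) + (ρ-R)/R) Σ √(1+n²)|c_n|²`,
both series converging in the corresponding weighted `L²` spaces. -/
theorem trace_extension_gradient_bound (R ρ : ℝ) (hR : 0 < R) (hRρ : R < ρ)
    (C₀ : ℝ) (hC₀ : 0 < C₀) (χ χ' : ℕ → ℝ → ℝ)
    (hderiv : ∀ n : ℕ, 1 ≤ n → ∀ r ∈ Set.Icc R ρ, HasDerivAt (χ n) (χ' n r) r)
    (hcont : ∀ n : ℕ, 1 ≤ n → ContinuousOn (χ' n) (Set.Icc R ρ))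
    (hχ0 : ∀ n : ℕ, 1 ≤ n → ∀ r ∈ Set.Icc R ρ, 0 ≤ χ n r)
    (hχ1 : ∀ n : ℕ, 1 ≤ n → ∀ r ∈ Set.Icc R ρ, χ n r ≤ 1)
    (hχsupp : ∀ n : ℕ, 1 ≤ n → ∀ r ∈ Set.Icc R ρ,
      r ≤ ρ - (ρ - R) / Real.sqrt (1 + (n : ℝ) ^ 2) → χ n r = 0)
    (hχ'supp : ∀ n : ℕ, 1 ≤ n → ∀ r ∈ Set.Icc R ρ,
      r ≤ ρ - (ρ - R) / Real.sqrt (1 + (n : ℝ) ^ 2) → χ' n r = 0)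
    (hχ'bd : ∀ n : ℕ, 1 ≤ n → ∀ r ∈ Set.Icc R ρ,
      |χ' n r| ≤ C₀ / ((ρ - R) / Real.sqrt (1 + (n : ℝ) ^ 2)))
    (c : ℕ → ℂ)
    (hc : Summable fun n : ℕ => Real.sqrt (1 + ((n : ℝ) + 1) ^ 2) * ‖c (n + 1)‖ ^ 2) :
    Tendsto (fun N : ℕ =>
        ∫ θ in (0 : ℝ)..Real.pi, ∫ r in R..ρ,
          ‖(∑ n ∈ Finset.range N,
              c (n + 1) * (χ' (n + 1) r : ℂ) * (Real.sin (((n : ℝ) + 1) * θ) : ℂ)) -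
            ∑' n : ℕ,
              c (n + 1) * (χ' (n + 1) r : ℂ) * (Real.sin (((n : ℝ) + 1) * θ) : ℂ)‖ ^ 2 * r)
      atTop (nhds 0) ∧
    Tendsto (fun N : ℕ =>
        ∫ θ in (0 : ℝ)..Real.pi, ∫ r in R..ρ,
          ‖(∑ n ∈ Finset.range N,
              c (n + 1) * (χ (n + 1) r : ℂ) * ((((n : ℝ) + 1) : ℂ) *
                (Real.cos (((n : ℝ) + 1) * θ) : ℂ))) -
            ∑' n : ℕ,
              c (n + 1) * (χ (n + 1) r : ℂ) * ((((n : ℝ) + 1) : ℂ) *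
                (Real.cos (((n : ℝ) + 1) * θ) : ℂ))‖ ^ 2 * r⁻¹)
      atTop (nhds 0) ∧
    ∫ θ in (0 : ℝ)..Real.pi, ∫ r in R..ρ,
        (‖∑' n : ℕ,
            c (n + 1) * (χ' (n + 1) r : ℂ) * (Real.sin (((n : ℝ) + 1) * θ) : ℂ)‖ ^ 2 +
          (r ^ 2)⁻¹ * ‖∑' n : ℕ,
            c (n + 1) * (χ (n + 1) r : ℂ) * ((((n : ℝ) + 1) : ℂ) *
              (Real.cos (((n : ℝ) + 1) * θ) : ℂ))‖ ^ 2) * r ≤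
      Real.pi / 2 * (C₀ ^ 2 * ρ / (ρ - R) + (ρ - R) / R) *
        ∑' n : ℕ, Real.sqrt (1 + ((n : ℝ) + 1) ^ 2) * ‖c (n + 1)‖ ^ 2 := by
  set q : ℕ → ℝ := fun n => Real.sqrt (1 + ((n:ℝ) + 1) ^ 2) with hq
  have hq0 : ∀ n, 0 < q n := fun n => Real.sqrt_pos.2 (by positivity)
  have hqsq : ∀ n, q n ^ 2 = 1 + ((n:ℝ) + 1) ^ 2 := fun n => Real.sq_sqrt (by positivity)
  have hqn : ∀ n : ℕ, (n:ℝ) ≤ q n := fun n => by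
    refine Real.le_sqrt_of_sq_le ?_
    have : (0:ℝ) ≤ n := by positivity
    nlinarith
  have hd : 0 < ρ - R := sub_pos.2 hRρ
  have hρ : 0 < ρ := hR.trans hRρ
  have hcast : ∀ n : ℕ, Real.sqrt (1 + ((n + 1 : ℕ) : ℝ) ^ 2) = q n := fun n => by
    simp [hq]
  have hδ : ∀ n, 0 < (ρ - R) / q n := fun n => div_pos hd (hq0 n)
  have hδ0 : Tendsto (fun n => (ρ - R) / q n) atTop (nhds 0) :=
    tendsto_const_nhds.div_atTop (tendsto_atTop_mono hqn tendsto_natCast_atTop_atTop)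
  have ha : ∀ n, 0 ≤ q n * ‖c (n + 1)‖ ^ 2 := fun n => by have := hq0 n; positivity
  have hIcc : ∀ r, r ∈ Set.Ioo R ρ → r ∈ Set.Icc R ρ := fun r hr => Set.Ioo_subset_Icc_self hr
  obtain ⟨T1, F1, hF1m, hF1, hF1b⟩ := aux_master R ρ hRρ
    (fun n θ => Real.sin (((n : ℝ) + 1) * θ)) (fun n => by fun_prop) aux_sin
    (fun n r => c (n + 1) * (χ' (n + 1) r : ℂ))
    (fun n => continuousOn_const.mul (Complex.continuous_ofReal.comp_continuousOn
      ((hcont (n + 1) (by omega)).mono Set.Ioo_subset_Icc_self)))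
    (fun r => r) measurable_id (fun n => (ρ - R) / q n)
    (fun n => ‖c (n + 1)‖ * (C₀ / ((ρ - R) / q n))) (fun n => q n * ‖c (n + 1)‖ ^ 2)
    ρ (C₀ ^ 2 * ρ / (ρ - R)) hδ hδ0 (fun n => by have := hδ n; positivity) hρ.le
    (fun n r hr h => by
      rw [hχ'supp (n + 1) (by omega) r (hIcc r hr) (by rw [hcast]; exact h)]; simp)
    (fun n r hr => by
      have := hχ'bd (n + 1) (by omega) r (hIcc r hr)
      rw [hcast] at this
      rw [norm_mul, Complex.norm_real, Real.norm_eq_abs]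
      gcongr)
    (fun r hr => by rw [abs_of_pos (hR.trans hr.1)]; exact hr.2.le)
    (by positivity) ha hc
    (fun n => by
      have := hq0 n
      apply le_of_eq
      field_simp)
  obtain ⟨T2, F2, hF2m, hF2, hF2b⟩ := aux_master R ρ hRρ
    (fun n θ => Real.cos (((n : ℝ) + 1) * θ)) (fun n => by fun_prop) aux_cos
    (fun n r => c (n + 1) * (χ (n + 1) r : ℂ) * (((n : ℝ) + 1) : ℂ))
    (fun n => (continuousOn_const.mul (Complex.continuous_ofReal.comp_continuousOn
      (fun r hr => (hderiv (n + 1) (by omega) r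
        (hIcc r hr)).continuousAt.continuousWithinAt))).mul continuousOn_const)
    (fun r => r⁻¹) measurable_inv (fun n => (ρ - R) / q n)
    (fun n => ‖c (n + 1)‖ * ((n:ℝ) + 1)) (fun n => q n * ‖c (n + 1)‖ ^ 2)
    R⁻¹ ((ρ - R) / R) hδ hδ0 (fun n => by positivity) (by positivity)
    (fun n r hr h => by
      rw [hχsupp (n + 1) (by omega) r (hIcc r hr) (by rw [hcast]; exact h)]; simp)
    (fun n r hr => by
      have h1 := hχ1 (n + 1) (by omega) r (hIcc r hr)
      have h0 := hχ0 (n + 1) (by omega) r (hIcc r hr)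
      have h2 : ‖(((n : ℝ) + 1) : ℂ)‖ = (n:ℝ) + 1 := by
        have : (((n : ℝ) + 1) : ℂ) = (((n:ℝ) + 1 : ℝ) : ℂ) := by push_cast; rfl
        rw [this, Complex.norm_real, Real.norm_eq_abs, abs_of_pos (by positivity)]
      rw [norm_mul, norm_mul, Complex.norm_real, Real.norm_eq_abs, abs_of_nonneg h0, h2]
      gcongr
      exact mul_le_of_le_one_right (norm_nonneg _) h1)
    (fun r hr => by
      rw [abs_of_pos (inv_pos.2 (hR.trans hr.1))]
      exact inv_anti₀ hR hr.1.le)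
    (by positivity) ha hc
    (fun n => by
      have h := hq0 n
      have h' : ((n:ℝ) + 1) ^ 2 / q n ≤ q n := by
        rw [div_le_iff₀ h, ← sq, hqsq]; linarith
      calc (‖c (n + 1)‖ * ((n:ℝ) + 1)) ^ 2 * R⁻¹ * ((ρ - R) / q n)
          = (ρ - R) / R * ‖c (n + 1)‖ ^ 2 * (((n:ℝ) + 1) ^ 2 / q n) := by
            field_simp
        _ ≤ (ρ - R) / R * ‖c (n + 1)‖ ^ 2 * q n := by gcongr
        _ = _ := by ring)
  simp only [mul_assoc] at T1 T2 hF1 hF2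
  refine ⟨by simpa only [mul_assoc] using T1, by simpa only [mul_assoc] using T2, ?_⟩
  set S := ∑' n, q n * ‖c (n + 1)‖ ^ 2 with hS
  have hS0 : 0 ≤ S := tsum_nonneg ha
  have hnn : 0 ≤ Real.pi / 2 * (C₀ ^ 2 * ρ / (ρ - R) + (ρ - R) / R) * S := by positivity
  refine (le_abs_self _).trans ?_
  rw [← Real.norm_eq_abs, ← ENNReal.ofReal_le_ofReal_iff hnn, ofReal_norm]
  refine (aux_iter R ρ hRρ _ (fun θ r => F1 θ r + F2 θ r) ?_).trans ?_
  · intro θ r hr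
    have hr0 : 0 < r := hR.trans hr.1
    rw [hF1 θ r hr, hF2 θ r hr, add_mul]
    refine (enorm_add_le _ _).trans ?_
    simp only [mul_assoc]
    refine add_le_add (le_of_eq ?_) (le_of_eq ?_)
    · rw [enorm_mul, enorm_pow, enorm_norm]
    · rw [mul_left_comm, show (r ^ 2)⁻¹ * r = r⁻¹ by field_simp, enorm_mul, enorm_pow, enorm_norm]
  · have hadd : ∀ θ, ∫⁻ r in Set.Ioo R ρ, (F1 θ r + F2 θ r) =
        (∫⁻ r in Set.Ioo R ρ, F1 θ r) + ∫⁻ r in Set.Ioo R ρ, F2 θ r := fun θ =>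
      lintegral_add_left (hF1m.comp measurable_prodMk_left) _
    simp_rw [hadd]
    have hm1 : Measurable fun θ => ∫⁻ r in Set.Ioo R ρ, F1 θ r :=
      hF1m.lintegral_prod_right'
    rw [lintegral_add_left hm1, mul_add, add_mul,
      ENNReal.ofReal_add (by positivity) (by positivity)]
    exact add_le_add hF1b hF2b
end
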